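/- arXiv:2301.10902 — 8 statements merged into one kernel-verified Lean document; each statement's English description precedes it below -/
import Mathlib

section
/- Fix an integer d ≥ 1 and let μ_d be the uniform probability measure on the closed unit ball B^d of ℝ^d. For R₁, R₂ ∈ [0,1]^d and R̂₁, R̂₂ ∈ {0,1}^d define Acc(R₁,R₂,R̂₁,R̂₂) := μ_d{r ∈ B^d : R₁·r > R₂·r and R̂₁·r > R̂₂·r} + μ_d{r ∈ B^d : R₂·r > R₁·r and R̂₂·r > R̂₁·r}. Then the infimum over R₁, R₂ ∈ [0,1]^d with R₁ ≠ R₂ of the supremum over R̂₁, R̂₂ ∈ {0,1}^d of Acc(R₁,R₂,R̂₁,R̂₂) equals 1 − arccos(1/√(Σ_{j=1}^d (√j − √(j−1))²))/π. -/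
open MeasureTheory
open scoped RealInnerProductSpace

/-- The uniform probability measure on the closed unit ball of `ℝ^d`. -/
noncomputable def unifBall (d : ℕ) : Measure (EuclideanSpace ℝ (Fin d)) :=
  (volume (Metric.closedBall (0 : EuclideanSpace ℝ (Fin d)) 1))⁻¹ •
    volume.restrict (Metric.closedBall (0 : EuclideanSpace ℝ (Fin d)) 1)

/-- The two-class prediction accuracy of the majority rule with true representations
`R₁, R₂` and binary representations `Rh₁, Rh₂`:
`μ_d{r : R₁·r > R₂·r ∧ R̂₁·r > R̂₂·r} + μ_d{r : R₂·r > R₁·r ∧ R̂₂·r > R̂₁·r}`. -/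
noncomputable def accTwo (d : ℕ) (R₁ R₂ Rh₁ Rh₂ : EuclideanSpace ℝ (Fin d)) : ℝ :=
  (unifBall d {r | ⟪R₁, r⟫ > ⟪R₂, r⟫ ∧ ⟪Rh₁, r⟫ > ⟪Rh₂, r⟫}).toReal +
  (unifBall d {r | ⟪R₂, r⟫ > ⟪R₁, r⟫ ∧ ⟪Rh₂, r⟫ > ⟪Rh₁, r⟫}).toReal

lemma aux_arc (α φ : ℝ) (h0 : 0 ≤ α) (hπ : α ≤ Real.pi) :
    volume ({t : ℝ | 0 < Real.cos (t + φ) * Real.cos (t + φ - α)} ∩ Set.Ioc 0 Real.pi)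
      = ENNReal.ofReal (Real.pi - α) := by
  have hper := (isAddFundamentalDomain_Ioc Real.pi_pos 0 volume).measure_set_eq
    (isAddFundamentalDomain_Ioc Real.pi_pos (α/2 - Real.pi/2 - φ) volume)
    (A := {t : ℝ | 0 < Real.cos (t + φ) * Real.cos (t + φ - α)})
    (measurableSet_lt (by fun_prop) (by fun_prop)) (by
      rintro ⟨g, hg⟩
      obtain ⟨n, rfl⟩ := AddSubgroup.mem_zmultiples_iff.mp hg
      ext t
      simp only [Set.mem_preimage, Set.mem_ofPred_eq, AddSubgroup.mk_vadd, vadd_eq_add, zsmul_eq_mul]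
      have e1 : (n:ℝ) * Real.pi + t + φ = (t + φ) + n * Real.pi := by ring
      have e2 : (t + φ) + n * Real.pi - α = (t + φ - α) + n * Real.pi := by ring
      rw [e1, e2, Real.cos_add_int_mul_pi, Real.cos_add_int_mul_pi]
      have : ((-1:ℝ)^n) * ((-1)^n) = 1 := by
        rw [← mul_zpow]; simp
      rw [show (-1:ℝ) ^ n * Real.cos (t + φ) * ((-1) ^ n * Real.cos (t + φ - α)) =
        ((-1:ℝ)^n * (-1)^n) * (Real.cos (t + φ) * Real.cos (t + φ - α)) by ring, this, one_mul])
  rw [zero_add] at hper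
  rw [hper]
  have : ({t : ℝ | 0 < Real.cos (t + φ) * Real.cos (t + φ - α)} ∩
      Set.Ioc (α/2 - Real.pi/2 - φ) (α/2 - Real.pi/2 - φ + Real.pi)) =
      (Set.Ioo (α - Real.pi/2 - φ) (Real.pi/2 - φ)) := by
    ext t
    simp only [Set.mem_inter_iff, Set.mem_ofPred_eq, Set.mem_Ioc, Set.mem_Ioo]
    have key : Real.cos (t + φ) * Real.cos (t + φ - α) =
        (Real.cos (2 * (t+φ) - α) - Real.cos (Real.pi - α)) / 2 := by
      rw [Real.cos_pi_sub, show 2 * (t+φ) - α = (t+φ) + (t + φ - α) by ring]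
      have hc : Real.cos α = Real.cos ((t+φ) - (t + φ - α)) := by congr 1; ring
      rw [hc, Real.cos_add (t+φ) (t+φ-α), Real.cos_sub (t+φ) (t+φ-α)]
      ring
    have key2 : ∀ s : ℝ, -Real.pi ≤ s → s ≤ Real.pi →
        (Real.cos (Real.pi - α) < Real.cos s ↔ |s| < Real.pi - α) := by
      intro s h1 h2
      rw [← Real.cos_abs s]
      exact Real.strictAntiOn_cos.lt_iff_gt ⟨by linarith, by linarith⟩
        ⟨abs_nonneg _, abs_le.mpr ⟨h1, h2⟩⟩
    rw [key]
    constructor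
    · rintro ⟨h, h1, h2⟩
      have := (key2 (2 * (t+φ) - α) (by linarith) (by linarith)).mp (by linarith)
      rw [abs_lt] at this
      constructor <;> linarith [this.1, this.2]
    · rintro ⟨h1, h2⟩
      have := (key2 (2 * (t+φ) - α) (by linarith) (by linarith)).mpr
        (abs_lt.mpr ⟨by linarith, by linarith⟩)
      refine ⟨by linarith, by linarith, by linarith⟩
  rw [this, Real.volume_Ioo]
  congr 1
  ring

/-- rotation in the plane spanned by `a, b` -/
noncomputable def rotLin {d : ℕ} (a b : EuclideanSpace ℝ (Fin d)) (θ : ℝ) :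
    EuclideanSpace ℝ (Fin d) →ₗ[ℝ] EuclideanSpace ℝ (Fin d) where
  toFun r := r + ((Real.cos θ - 1) * ⟪a, r⟫ - Real.sin θ * ⟪b, r⟫) • a +
    ((Real.cos θ - 1) * ⟪b, r⟫ + Real.sin θ * ⟪a, r⟫) • b
  map_add' x y := by
    simp only [inner_add_right]
    module
  map_smul' c x := by
    simp only [inner_smul_right, RingHom.id_apply]
    module

lemma rotLin_norm {d : ℕ} (a b : EuclideanSpace ℝ (Fin d)) (ha : ‖a‖ = 1) (hb : ‖b‖ = 1)
    (hab : ⟪a, b⟫ = 0) (θ : ℝ) (r : EuclideanSpace ℝ (Fin d)) : ‖rotLin a b θ r‖ = ‖r‖ := by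
  have haa : ⟪a, a⟫ = 1 := by rw [real_inner_self_eq_norm_sq, ha]; norm_num
  have hbb : ⟪b, b⟫ = 1 := by rw [real_inner_self_eq_norm_sq, hb]; norm_num
  have hba : ⟪b, a⟫ = 0 := by rw [real_inner_comm, hab]
  have : ‖rotLin a b θ r‖ ^ 2 = ‖r‖ ^ 2 := by
    rw [← real_inner_self_eq_norm_sq, ← real_inner_self_eq_norm_sq]
    simp only [rotLin, LinearMap.coe_mk, AddHom.coe_mk, inner_add_left, inner_add_right,
      inner_smul_left, inner_smul_right, haa, hbb, hab, hba, real_inner_comm r a,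
      real_inner_comm r b, conj_trivial]
    have hx := real_inner_comm a r
    have hy := real_inner_comm b r
    rw [hx, hy]
    have h := Real.sin_sq_add_cos_sq θ
    have h' : Real.sin θ ^ 2 = 1 - Real.cos θ ^ 2 := by linarith
    ring_nf
    rw [h']
    ring
  exact (sq_eq_sq₀ (norm_nonneg _) (norm_nonneg _)).mp this

lemma rotLin_inner_a {d : ℕ} (a b : EuclideanSpace ℝ (Fin d)) (ha : ‖a‖ = 1)
    (hab : ⟪a, b⟫ = 0) (θ : ℝ) (r : EuclideanSpace ℝ (Fin d)) :
    ⟪a, rotLin a b θ r⟫ = Real.cos θ * ⟪a, r⟫ - Real.sin θ * ⟪b, r⟫ := by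
  have haa : ⟪a, a⟫ = 1 := by rw [real_inner_self_eq_norm_sq, ha]; norm_num
  simp only [rotLin, LinearMap.coe_mk, AddHom.coe_mk, inner_add_right, inner_smul_right, haa, hab]
  ring

lemma rotLin_inner_b {d : ℕ} (a b : EuclideanSpace ℝ (Fin d)) (hb : ‖b‖ = 1)
    (hab : ⟪a, b⟫ = 0) (θ : ℝ) (r : EuclideanSpace ℝ (Fin d)) :
    ⟪b, rotLin a b θ r⟫ = Real.sin θ * ⟪a, r⟫ + Real.cos θ * ⟪b, r⟫ := by
  have hbb : ⟪b, b⟫ = 1 := by rw [real_inner_self_eq_norm_sq, hb]; norm_num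
  have hba : ⟪b, a⟫ = 0 := by rw [real_inner_comm, hab]
  simp only [rotLin, LinearMap.coe_mk, AddHom.coe_mk, inner_add_right, inner_smul_right, hbb, hba]
  ring

instance unifBall_prob (d : ℕ) : IsProbabilityMeasure (unifBall d) := by
  constructor
  simp only [unifBall, Measure.smul_apply, smul_eq_mul, Measure.restrict_apply_univ]
  apply ENNReal.inv_mul_cancel
  · exact (Metric.measure_closedBall_pos volume _ one_pos).ne'
  · exact measure_closedBall_lt_top.ne

lemma unifBall_isom {d : ℕ} (L : EuclideanSpace ℝ (Fin d) ≃ₗᵢ[ℝ] EuclideanSpace ℝ (Fin d))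
    {S : Set (EuclideanSpace ℝ (Fin d))} (hS : MeasurableSet S) :
    unifBall d (L ⁻¹' S) = unifBall d S := by
  simp only [unifBall, Measure.smul_apply]
  congr 1
  have hL := L.measurePreserving
  rw [Measure.restrict_apply (hL.measurable hS), Measure.restrict_apply hS,
    ← hL.measure_preimage (hS.inter measurableSet_closedBall).nullMeasurableSet]
  congr 1
  ext x
  simp

lemma unifBall_hyperplane {d : ℕ} (u : EuclideanSpace ℝ (Fin d)) (hu : u ≠ 0) :
    unifBall d {r | ⟪u, r⟫ = 0} = 0 := by
  have h : volume {r : EuclideanSpace ℝ (Fin d) | ⟪u, r⟫ = 0} = 0 := by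
    have := Measure.addHaar_submodule volume (LinearMap.ker (innerₛₗ ℝ u)) (by
      intro h
      rw [LinearMap.ker_eq_top] at h
      have := congrArg (fun f => f u) h
      simp at this
      exact hu this)
    convert this
    ext r
    simp
  simp only [unifBall, Measure.smul_apply, smul_eq_mul]
  rw [le_antisymm ((Measure.restrict_apply_le _ _).trans h.le) zero_le, mul_zero]

lemma wedge_on {d : ℕ} (a b : EuclideanSpace ℝ (Fin d)) (ha : ‖a‖ = 1) (hb : ‖b‖ = 1)
    (hab : ⟪a, b⟫ = 0) (α : ℝ) (h0 : 0 ≤ α) (hπ : α ≤ Real.pi) :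
    unifBall d {r | 0 < ⟪a, r⟫ * (Real.cos α * ⟪a, r⟫ + Real.sin α * ⟪b, r⟫)}
      = ENNReal.ofReal (1 - α / Real.pi) := by
  set S := {r : EuclideanSpace ℝ (Fin d) |
    0 < ⟪a, r⟫ * (Real.cos α * ⟪a, r⟫ + Real.sin α * ⟪b, r⟫)} with hS
  have hSm : MeasurableSet S := measurableSet_lt (by fun_prop) (by fun_prop)
  let T : Set (ℝ × EuclideanSpace ℝ (Fin d)) := {p | rotLin a b p.1 p.2 ∈ S}
  have hT : MeasurableSet T := by
    simp only [T, hS, Set.mem_ofPred_eq, rotLin_inner_a a b ha hab, rotLin_inner_b a b hb hab]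
    exact measurableSet_lt (by fun_prop) (by fun_prop)
  have h1 : ((volume.restrict (Set.Ioc 0 Real.pi)).prod (unifBall d)) T
      = ENNReal.ofReal Real.pi * unifBall d S := by
    rw [Measure.prod_apply hT]
    have : ∀ θ : ℝ, unifBall d (Prod.mk θ ⁻¹' T) = unifBall d S := by
      intro θ
      let L : EuclideanSpace ℝ (Fin d) →ₗᵢ[ℝ] EuclideanSpace ℝ (Fin d) :=
        ⟨rotLin a b θ, rotLin_norm a b ha hb hab θ⟩
      rw [← unifBall_isom (L.toLinearIsometryEquiv rfl) hSm]
      rfl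
    simp only [this]
    simp [mul_comm]
  have h2 : ((volume.restrict (Set.Ioc 0 Real.pi)).prod (unifBall d)) T
      = ENNReal.ofReal (Real.pi - α) := by
    rw [Measure.prod_apply_symm hT]
    have hae : ∀ᵐ r ∂(unifBall d), (volume.restrict (Set.Ioc 0 Real.pi))
        ((fun θ => (θ, r)) ⁻¹' T) = ENNReal.ofReal (Real.pi - α) := by
      have ha0 : a ≠ 0 := by rintro rfl; simp at ha
      have hn : ∀ᵐ r ∂(unifBall d), ¬ ⟪a, r⟫ = 0 := by
        rw [ae_iff]; simpa using unifBall_hyperplane a ha0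
      filter_upwards [hn] with r hr
      rw [Measure.restrict_apply (hT.preimage (by fun_prop))]
      set z : ℂ := ⟨⟪a, r⟫, ⟪b, r⟫⟩ with hz
      have hz0 : 0 < ‖z‖ := by
        rw [norm_pos_iff]
        intro h
        exact hr (congrArg Complex.re h)
      have hx : ⟪a, r⟫ = ‖z‖ * Real.cos z.arg := (Complex.norm_mul_cos_arg z).symm
      have hy : ⟪b, r⟫ = ‖z‖ * Real.sin z.arg := (Complex.norm_mul_sin_arg z).symm
      rw [← aux_arc α z.arg h0 hπ]
      congr 2
      ext θ
      simp only [T, hS, Set.mem_preimage, Set.mem_ofPred_eq, rotLin_inner_a a b ha hab,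
        rotLin_inner_b a b hb hab]
      have e : (Real.cos θ * ⟪a, r⟫ - Real.sin θ * ⟪b, r⟫) *
          (Real.cos α * (Real.cos θ * ⟪a, r⟫ - Real.sin θ * ⟪b, r⟫) +
            Real.sin α * (Real.sin θ * ⟪a, r⟫ + Real.cos θ * ⟪b, r⟫)) =
          ‖z‖ ^ 2 * (Real.cos (θ + z.arg) * Real.cos (θ + z.arg - α)) := by
        rw [Real.cos_sub (θ + z.arg), Real.cos_add, Real.sin_add, hx, hy]
        ring
      rw [e]
      exact mul_pos_iff_of_pos_left (by positivity)
    rw [lintegral_congr_ae hae]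
    simp
  have h3 := h1.symm.trans h2
  have hp : ENNReal.ofReal Real.pi ≠ 0 := by simp [Real.pi_pos]
  rw [show 1 - α / Real.pi = (Real.pi - α) / Real.pi by field_simp,
    ENNReal.ofReal_div_of_pos Real.pi_pos, ← h3, mul_comm,
    ENNReal.mul_div_cancel_right hp ENNReal.ofReal_ne_top]

lemma wedge_gen {d : ℕ} (u v : EuclideanSpace ℝ (Fin d)) (hu : u ≠ 0) (hv : v ≠ 0) :
    unifBall d {r | 0 < ⟪u, r⟫ * ⟪v, r⟫}
      = ENNReal.ofReal (1 - InnerProductGeometry.angle u v / Real.pi) := by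
  set α := InnerProductGeometry.angle u v with hα
  have hun : 0 < ‖u‖ := norm_pos_iff.mpr hu
  have hvn : 0 < ‖v‖ := norm_pos_iff.mpr hv
  by_cases hs : Real.sin α = 0
  · rcases InnerProductGeometry.sin_eq_zero_iff_angle_eq_zero_or_angle_eq_pi.mp hs with h | h
    · rw [hα, h]
      obtain ⟨-, c, hc, rfl⟩ := InnerProductGeometry.angle_eq_zero_iff.mp h
      simp only [zero_div, sub_zero, ENNReal.ofReal_one]
      rw [← mem_ae_iff_prob_eq_one (measurableSet_lt (by fun_prop) (by fun_prop))]
      have hn : ∀ᵐ r ∂(unifBall d), ¬ ⟪u, r⟫ = 0 := by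
        rw [ae_iff]; simpa using unifBall_hyperplane u hu
      filter_upwards [hn] with r hr
      simp only [inner_smul_left, conj_trivial]
      have : 0 < ⟪u, r⟫ * ⟪u, r⟫ := mul_self_pos.mpr hr
      nlinarith
    · rw [hα, h]
      obtain ⟨-, c, hc, rfl⟩ := InnerProductGeometry.angle_eq_pi_iff.mp h
      rw [div_self Real.pi_ne_zero, sub_self, ENNReal.ofReal_zero]
      convert measure_empty (μ := unifBall d)
      ext r
      simp only [Set.mem_ofPred_eq, Set.mem_empty_iff_false, iff_false, inner_smul_left,
        conj_trivial, not_lt]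
      nlinarith [sq_nonneg ⟪u, r⟫]
  · have hs' : 0 < Real.sin α :=
      lt_of_le_of_ne (InnerProductGeometry.sin_angle_nonneg u v) (Ne.symm hs)
    have hc : Real.cos α * (‖u‖ * ‖v‖) = ⟪u, v⟫ :=
      InnerProductGeometry.cos_angle_mul_norm_mul_norm u v
    let a := ‖u‖⁻¹ • u
    let b := (‖v‖ * Real.sin α)⁻¹ • (v - (‖v‖ * Real.cos α) • a)
    have huu : ⟪u, u⟫ = ‖u‖ ^ 2 := real_inner_self_eq_norm_sq u
    have hvv : ⟪v, v⟫ = ‖v‖ ^ 2 := real_inner_self_eq_norm_sq v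
    have ha : ‖a‖ = 1 := by
      simp only [a, norm_smul, norm_inv, norm_norm]
      field_simp
    have haa : ⟪a, a⟫ = 1 := by rw [real_inner_self_eq_norm_sq, ha]; norm_num
    have hav : ⟪a, v⟫ = ‖v‖ * Real.cos α := by
      simp only [a, inner_smul_left, conj_trivial, ← hc]
      field_simp
    have hva : ⟪v, a⟫ = ‖v‖ * Real.cos α := by rw [real_inner_comm, hav]
    have hab : ⟪a, b⟫ = 0 := by
      simp only [b, inner_smul_right, inner_sub_right, haa, hav]
      ring
    have hb : ‖b‖ = 1 := by
      have : ‖b‖ ^ 2 = 1 := by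
        rw [← real_inner_self_eq_norm_sq]
        simp only [b, inner_smul_right, inner_smul_left, inner_sub_right, inner_sub_left, haa, hav,
          hva, hvv, conj_trivial]
        have h := Real.sin_sq_add_cos_sq α
        field_simp
        linarith
      nlinarith [norm_nonneg b]
    rw [← wedge_on a b ha hb hab α (InnerProductGeometry.angle_nonneg u v)
      (InnerProductGeometry.angle_le_pi u v)]
    congr 1
    ext r
    simp only [Set.mem_ofPred_eq]
    have e1 : ⟪u, r⟫ = ‖u‖ * ⟪a, r⟫ := by
      simp only [a, inner_smul_left, conj_trivial]
      field_simp
    have e2 : ⟪v, r⟫ = ‖v‖ * (Real.cos α * ⟪a, r⟫ + Real.sin α * ⟪b, r⟫) := by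
      simp only [b, inner_smul_left, conj_trivial, inner_sub_left]
      field_simp
      ring
    rw [e1, e2, show ∀ x y z w : ℝ, x * y * (z * w) = (x * z) * (y * w) by intros; ring]
    exact mul_pos_iff_of_pos_left (by positivity)

lemma accTwo_eq {d : ℕ} (R₁ R₂ Rh₁ Rh₂ : EuclideanSpace ℝ (Fin d)) :
    accTwo d R₁ R₂ Rh₁ Rh₂ =
      (unifBall d {r | 0 < ⟪R₁ - R₂, r⟫ * ⟪Rh₁ - Rh₂, r⟫}).toReal := by
  unfold accTwo
  rw [← ENNReal.toReal_add (measure_ne_top _ _) (measure_ne_top _ _), ← measure_union]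
  · congr 2
    ext r
    simp only [Set.mem_union, Set.mem_ofPred_eq, inner_sub_left, mul_pos_iff, sub_pos, sub_neg, gt_iff_lt]
  · rw [Set.disjoint_left]
    rintro r ⟨h1, _⟩ ⟨h2, _⟩
    exact lt_asymm h1 h2
  · apply MeasurableSet.inter
    · exact measurableSet_lt (f := fun r => ⟪R₁, r⟫) (g := fun r => ⟪R₂, r⟫) (by fun_prop) (by fun_prop)
    · exact measurableSet_lt (f := fun r => ⟪Rh₁, r⟫) (g := fun r => ⟪Rh₂, r⟫) (by fun_prop) (by fun_prop)

lemma accTwo_angle {d : ℕ} (R₁ R₂ Rh₁ Rh₂ : EuclideanSpace ℝ (Fin d)) (h : R₁ - R₂ ≠ 0)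
    (h' : Rh₁ - Rh₂ ≠ 0) :
    accTwo d R₁ R₂ Rh₁ Rh₂ =
      1 - Real.arccos (⟪R₁ - R₂, Rh₁ - Rh₂⟫ / (‖R₁ - R₂‖ * ‖Rh₁ - Rh₂‖)) / Real.pi := by
  rw [accTwo_eq, wedge_gen _ _ h h', ENNReal.toReal_ofReal]
  · rfl
  · rw [sub_nonneg, div_le_one Real.pi_pos]
    exact InnerProductGeometry.angle_le_pi _ _

/-- the extremal weights -/
noncomputable def wt (i : ℕ) : ℝ := Real.sqrt ((i : ℝ) + 1) - Real.sqrt i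

lemma wt_nonneg (i : ℕ) : 0 ≤ wt i := by
  unfold wt
  rw [sub_nonneg]
  exact Real.sqrt_le_sqrt (by linarith)

lemma wt_eq (i : ℕ) : wt i = 1 / (Real.sqrt ((i : ℝ) + 1) + Real.sqrt i) := by
  have h1 : 0 < Real.sqrt ((i : ℝ) + 1) := Real.sqrt_pos.mpr (by positivity)
  have h2 := Real.sqrt_nonneg (i : ℝ)
  have h3 := Real.sq_sqrt (show (0:ℝ) ≤ (i:ℝ) + 1 by positivity)
  have h4 := Real.sq_sqrt (show (0:ℝ) ≤ (i:ℝ) by positivity)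
  unfold wt
  rw [eq_div_iff (by positivity)]
  nlinarith

lemma wt_antitone : Antitone wt := by
  intro i j hij
  rw [wt_eq, wt_eq]
  have h1 : 0 < Real.sqrt ((i : ℝ) + 1) := Real.sqrt_pos.mpr (by positivity)
  have hij' : (i : ℝ) ≤ j := by exact_mod_cast hij
  gcongr

lemma wt_le_one (i : ℕ) : wt i ≤ 1 := by
  refine (wt_antitone (Nat.zero_le i)).trans ?_
  simp [wt]

lemma wt_prefix (k : ℕ) : ∑ i ∈ Finset.range k, wt i = Real.sqrt k := by
  induction k with
  | zero => simp
  | succ n ih => rw [Finset.sum_range_succ, ih, wt]; push_cast; ring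

lemma wt_sum_le (s : Finset ℕ) : ∑ i ∈ s, wt i ≤ Real.sqrt s.card := by
  induction s using Finset.induction_on_max with
  | empty => simp
  | insert a s hs ih =>
    have ha : a ∉ s := fun h => lt_irrefl _ (hs a h)
    rw [Finset.sum_insert ha, Finset.card_insert_of_notMem ha]
    have hc : s.card ≤ a := by
      have : s ⊆ Finset.range a := fun x hx => Finset.mem_range.mpr (hs x hx)
      simpa using Finset.card_le_card this
    have := wt_antitone hc
    have e : wt s.card = Real.sqrt ((s.card + 1 : ℕ) : ℝ) - Real.sqrt s.card := by
      simp [wt]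
    linarith

lemma abel_le (p x y : ℕ → ℝ) (hp : Antitone p) (hp0 : ∀ i, 0 ≤ p i) (d : ℕ)
    (h : ∀ k ≤ d, ∑ i ∈ Finset.range k, x i ≤ ∑ i ∈ Finset.range k, y i) :
    ∑ i ∈ Finset.range d, p i * x i ≤ ∑ i ∈ Finset.range d, p i * y i := by
  have key : ∀ n, n + 1 ≤ d → p n * (∑ i ∈ Finset.range (n+1), (y i - x i)) ≤
      ∑ i ∈ Finset.range (n+1), p i * (y i - x i) := by
    intro n
    induction n with
    | zero => intro _; simp
    | succ n ih =>
      intro hn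
      rw [Finset.sum_range_succ, Finset.sum_range_succ (fun i => p i * (y i - x i))]
      have h1 := ih (by omega)
      have h2 := h (n+1) (by omega)
      have h3 : 0 ≤ ∑ i ∈ Finset.range (n+1), (y i - x i) := by
        rw [Finset.sum_sub_distrib]; linarith
      have h4 := mul_le_mul_of_nonneg_right (hp (Nat.le_succ n)) h3
      simp only [Nat.succ_eq_add_one] at h4
      linarith
  rcases d with _ | n
  · simp
  · have h1 := key n le_rfl
    have h2 := h (n+1) le_rfl
    have h3 : 0 ≤ ∑ i ∈ Finset.range (n+1), (y i - x i) := by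
      rw [Finset.sum_sub_distrib]; linarith
    have h4 := mul_nonneg (hp0 n) h3
    simp only [mul_sub] at h1
    rw [Finset.sum_sub_distrib] at h1
    rw [Finset.sum_sub_distrib] at h4 h1
    linarith

lemma exists_prefix (d : ℕ) (hd : 1 ≤ d) (g : ℕ → ℝ) (hg : Antitone g) (hg0 : ∀ i, 0 ≤ g i) :
    ∃ k, 1 ≤ k ∧ k ≤ d ∧ Real.sqrt (∑ i ∈ Finset.range d, g i ^ 2) ≤
      (∑ i ∈ Finset.range k, g i) / Real.sqrt k *
        Real.sqrt (∑ i ∈ Finset.range d, wt i ^ 2) := by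
  obtain ⟨k, hk, hmax⟩ := Finset.exists_max_image (Finset.Icc 1 d)
    (fun k : ℕ => (∑ i ∈ Finset.range k, g i) / Real.sqrt k) ⟨1, by simp [hd]⟩
  rw [Finset.mem_Icc] at hk
  refine ⟨k, hk.1, hk.2, ?_⟩
  set c := (∑ i ∈ Finset.range k, g i) / Real.sqrt k with hc
  have hc0 : 0 ≤ c := div_nonneg (Finset.sum_nonneg fun i _ => hg0 i) (Real.sqrt_nonneg _)
  have hpre : ∀ m ≤ d, ∑ i ∈ Finset.range m, g i ≤ ∑ i ∈ Finset.range m, c * wt i := by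
    intro m hm
    rcases Nat.eq_zero_or_pos m with rfl | hm0
    · simp
    · have := hmax m (Finset.mem_Icc.mpr ⟨hm0, hm⟩)
      rw [← Finset.mul_sum, wt_prefix]
      rwa [div_le_iff₀ (Real.sqrt_pos.mpr (by exact_mod_cast hm0))] at this
  have h1 := abel_le g g _ hg hg0 d hpre
  have h2 := abel_le wt g _ wt_antitone wt_nonneg d hpre
  have h3 : ∑ i ∈ Finset.range d, g i ^ 2 ≤ c ^ 2 * ∑ i ∈ Finset.range d, wt i ^ 2 := by
    calc ∑ i ∈ Finset.range d, g i ^ 2 = ∑ i ∈ Finset.range d, g i * g i := by simp only [sq]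
      _ ≤ ∑ i ∈ Finset.range d, g i * (c * wt i) := h1
      _ = c * ∑ i ∈ Finset.range d, wt i * g i := by
        rw [Finset.mul_sum]; exact Finset.sum_congr rfl fun i _ => by ring
      _ ≤ c * ∑ i ∈ Finset.range d, wt i * (c * wt i) := by gcongr
      _ = _ := by
        rw [Finset.mul_sum, Finset.mul_sum]; exact Finset.sum_congr rfl fun i _ => by ring
  calc _ ≤ Real.sqrt (c ^ 2 * ∑ i ∈ Finset.range d, wt i ^ 2) := Real.sqrt_le_sqrt h3
    _ = _ := by rw [Real.sqrt_mul (sq_nonneg c), Real.sqrt_sq hc0]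

lemma lower_comb (d : ℕ) (hd : 1 ≤ d) (u : EuclideanSpace ℝ (Fin d)) (hu : u ≠ 0) :
    ∃ Rh₁ Rh₂ : EuclideanSpace ℝ (Fin d),
      (∀ i, Rh₁ i = 0 ∨ Rh₁ i = 1) ∧ (∀ i, Rh₂ i = 0 ∨ Rh₂ i = 1) ∧ Rh₁ - Rh₂ ≠ 0 ∧
      1 / Real.sqrt (∑ i ∈ Finset.range d, wt i ^ 2) ≤
        ⟪u, Rh₁ - Rh₂⟫ / (‖u‖ * ‖Rh₁ - Rh₂‖) := by
  let σ := Tuple.sort (fun i => -|u i|)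
  have hσ : Monotone ((fun i => -|u i|) ∘ σ) := Tuple.monotone_sort _
  let g : ℕ → ℝ := fun n => if h : n < d then |u (σ ⟨n, h⟩)| else 0
  have hg0 : ∀ i, 0 ≤ g i := by
    intro i; simp only [g]; split_ifs <;> positivity
  have hg : Antitone g := by
    intro i j hij
    by_cases hj : j < d
    · have hi : i < d := by omega
      simp only [g, hi, hj, dif_pos]
      have := hσ (show (⟨i, hi⟩ : Fin d) ≤ ⟨j, hj⟩ from hij)
      simp only [Function.comp] at this
      linarith
    · simp only [g, hj, dif_neg, not_false_eq_true]
      exact hg0 i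
  have hgF : ∀ i : Fin d, g i = |u (σ i)| := by
    intro i; simp [g]
  obtain ⟨k, hk1, hkd, hk⟩ := exists_prefix d hd g hg hg0
  let R₁ : EuclideanSpace ℝ (Fin d) :=
    WithLp.toLp 2 (fun i => if (σ.symm i : ℕ) < k ∧ 0 ≤ u i then 1 else 0)
  let R₂ : EuclideanSpace ℝ (Fin d) :=
    WithLp.toLp 2 (fun i => if (σ.symm i : ℕ) < k ∧ u i < 0 then 1 else 0)
  have hfilter : Finset.filter (fun n => n < k) (Finset.range d) = Finset.range k := by
    ext n; simp only [Finset.mem_filter, Finset.mem_range]; omega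
  have hnorm : ‖R₁ - R₂‖ = Real.sqrt k := by
    rw [EuclideanSpace.norm_eq]
    congr 1
    have : ∀ i, ‖(R₁ - R₂) i‖ ^ 2 = if (σ.symm i : ℕ) < k then (1:ℝ) else 0 := by
      intro i
      simp only [R₁, R₂, PiLp.sub_apply]
      by_cases h1 : (σ.symm i : ℕ) < k <;> by_cases h2 : 0 ≤ u i <;>
        simp [h1, h2, not_lt.mpr, not_le.mp]
    simp only [this]
    rw [Equiv.sum_comp σ.symm (fun j : Fin d => if (j : ℕ) < k then (1:ℝ) else 0),
      Fin.sum_univ_eq_sum_range (fun n => if n < k then (1:ℝ) else 0) d, ← Finset.sum_filter,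
      hfilter]
    simp
  have hinner : ⟪u, R₁ - R₂⟫ = ∑ i ∈ Finset.range k, g i := by
    rw [PiLp.inner_apply]
    have : ∀ i, ⟪u i, (R₁ - R₂) i⟫ = if (σ.symm i : ℕ) < k then g (σ.symm i) else 0 := by
      intro i
      rw [hgF, Equiv.apply_symm_apply]
      simp only [R₁, R₂, PiLp.sub_apply]
      by_cases h1 : (σ.symm i : ℕ) < k <;> by_cases h2 : 0 ≤ u i
      · simp [h1, h2, not_lt.mpr, abs_of_nonneg]
      · simp [h1, h2, not_le.mp h2, abs_of_neg]
      · simp [h1]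
      · simp [h1]
    simp only [this]
    rw [Equiv.sum_comp σ.symm (fun j : Fin d => if (j : ℕ) < k then g j else 0),
      Fin.sum_univ_eq_sum_range (fun n => if n < k then g n else 0) d, ← Finset.sum_filter,
      hfilter]
  have hun : ‖u‖ = Real.sqrt (∑ i ∈ Finset.range d, g i ^ 2) := by
    rw [EuclideanSpace.norm_eq]
    congr 1
    rw [← Fin.sum_univ_eq_sum_range (fun n => g n ^ 2) d,
      ← Equiv.sum_comp σ (fun i => ‖u i‖ ^ 2)]
    simp [hgF]
  have hk0 : 0 < Real.sqrt (k : ℝ) := Real.sqrt_pos.mpr (by exact_mod_cast hk1)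
  have hS : 0 < Real.sqrt (∑ i ∈ Finset.range d, wt i ^ 2) := by
    apply Real.sqrt_pos.mpr
    refine lt_of_lt_of_le ?_ (Finset.single_le_sum (fun i _ => sq_nonneg (wt i))
      (Finset.mem_range.mpr hd))
    simp [wt]
  have hupos : 0 < ‖u‖ := norm_pos_iff.mpr hu
  refine ⟨R₁, R₂, ?_, ?_, ?_, ?_⟩
  · intro i; simp only [R₁]; split_ifs <;> simp
  · intro i; simp only [R₂]; split_ifs <;> simp
  · rw [← norm_pos_iff, hnorm]; exact hk0
  · rw [hinner, hnorm, div_le_div_iff₀ hS (by positivity)]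
    rw [← hun] at hk
    rw [div_mul_eq_mul_div, le_div_iff₀ hk0] at hk
    linarith

lemma upper_comb (d : ℕ) (w v : EuclideanSpace ℝ (Fin d)) (hw : ∀ i : Fin d, w i = wt i)
    (hv : ∀ i, v i = 0 ∨ v i = 1 ∨ v i = -1) : ⟪w, v⟫ ≤ ‖v‖ := by
  let s : Finset (Fin d) := Finset.univ.filter (fun i => v i ≠ 0)
  have hn : ‖v‖ = Real.sqrt s.card := by
    rw [EuclideanSpace.norm_eq]
    congr 1
    have : ∀ i, ‖v i‖ ^ 2 = if v i ≠ 0 then (1:ℝ) else 0 := by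
      intro i; rcases hv i with h | h | h <;> simp [h]
    simp only [this]
    rw [← Finset.sum_filter]
    simp [s]
  have hi : ⟪w, v⟫ ≤ ∑ i ∈ s, wt i := by
    rw [PiLp.inner_apply, Finset.sum_filter]
    apply Finset.sum_le_sum
    intro i _
    have := wt_nonneg i
    rcases hv i with h | h | h <;> simp [h, hw] <;> linarith
  rw [hn]
  refine hi.trans ?_
  have := wt_sum_le (s.map Fin.valEmbedding)
  simpa using this

theorem worst_case_two_class_accuracy (d : ℕ) (hd : 1 ≤ d) :
    sInf {a : ℝ | ∃ R₁ R₂ : EuclideanSpace ℝ (Fin d),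
      (∀ i, R₁ i ∈ Set.Icc (0:ℝ) 1) ∧ (∀ i, R₂ i ∈ Set.Icc (0:ℝ) 1) ∧ R₁ ≠ R₂ ∧
      a = sSup {b : ℝ | ∃ Rh₁ Rh₂ : EuclideanSpace ℝ (Fin d),
        (∀ i, Rh₁ i = 0 ∨ Rh₁ i = 1) ∧ (∀ i, Rh₂ i = 0 ∨ Rh₂ i = 1) ∧
        b = accTwo d R₁ R₂ Rh₁ Rh₂}} =
    1 - Real.arccos (1 / Real.sqrt (∑ j ∈ Finset.Icc 1 d,
      (Real.sqrt (j : ℝ) - Real.sqrt ((j : ℝ) - 1)) ^ 2)) / Real.pi := by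
  have hsum : ∑ j ∈ Finset.Icc 1 d, (Real.sqrt (j : ℝ) - Real.sqrt ((j : ℝ) - 1)) ^ 2 =
      ∑ i ∈ Finset.range d, wt i ^ 2 := by
    rw [Finset.range_eq_Ico, show Finset.Icc 1 d = Finset.Ico (0 + 1) (d + 1) by ext; simp,
      ← Finset.sum_Ico_add' (fun j : ℕ => (Real.sqrt (j : ℝ) - Real.sqrt ((j : ℝ) - 1)) ^ 2)]
    refine Finset.sum_congr rfl fun i _ => ?_
    simp [wt]
  rw [hsum]
  set A := 1 - Real.arccos (1 / Real.sqrt (∑ i ∈ Finset.range d, wt i ^ 2)) / Real.pi with hA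
  have hbdd : ∀ R₁ R₂ : EuclideanSpace ℝ (Fin d), BddAbove
      {b : ℝ | ∃ Rh₁ Rh₂ : EuclideanSpace ℝ (Fin d),
        (∀ i, Rh₁ i = 0 ∨ Rh₁ i = 1) ∧ (∀ i, Rh₂ i = 0 ∨ Rh₂ i = 1) ∧
        b = accTwo d R₁ R₂ Rh₁ Rh₂} := by
    intro R₁ R₂
    refine ⟨1, ?_⟩
    rintro b ⟨Rh₁, Rh₂, -, -, rfl⟩
    rw [accTwo_eq]
    exact measureReal_le_one
  have hlow : ∀ R₁ R₂ : EuclideanSpace ℝ (Fin d), R₁ ≠ R₂ → A ≤ sSup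
      {b : ℝ | ∃ Rh₁ Rh₂ : EuclideanSpace ℝ (Fin d),
        (∀ i, Rh₁ i = 0 ∨ Rh₁ i = 1) ∧ (∀ i, Rh₂ i = 0 ∨ Rh₂ i = 1) ∧
        b = accTwo d R₁ R₂ Rh₁ Rh₂} := by
    intro R₁ R₂ hne
    have hne' := sub_ne_zero.mpr hne
    obtain ⟨Rh₁, Rh₂, h1, h2, h3, h4⟩ := lower_comb d hd (R₁ - R₂) hne'
    refine le_trans ?_ (le_csSup (hbdd R₁ R₂) ⟨Rh₁, Rh₂, h1, h2, rfl⟩)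
    rw [accTwo_angle _ _ _ _ hne' h3]
    have := Real.arccos_le_arccos h4
    have := div_le_div_of_nonneg_right this Real.pi_pos.le
    linarith
  let w : EuclideanSpace ℝ (Fin d) := WithLp.toLp 2 (fun i => wt i)
  have hw : ∀ i : Fin d, w i = wt i := fun i => rfl
  have hw0 : w ≠ 0 := by
    intro h
    have := congrArg (fun x : EuclideanSpace ℝ (Fin d) => x ⟨0, hd⟩) h
    simp [hw, wt] at this
  have hwn : ‖w‖ = Real.sqrt (∑ i ∈ Finset.range d, wt i ^ 2) := by
    rw [EuclideanSpace.norm_eq, ← Fin.sum_univ_eq_sum_range (fun n => wt n ^ 2) d]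
    simp [hw]
  have hup : sSup {b : ℝ | ∃ Rh₁ Rh₂ : EuclideanSpace ℝ (Fin d),
        (∀ i, Rh₁ i = 0 ∨ Rh₁ i = 1) ∧ (∀ i, Rh₂ i = 0 ∨ Rh₂ i = 1) ∧
        b = accTwo d w 0 Rh₁ Rh₂} ≤ A := by
    apply csSup_le
    · exact ⟨_, 0, 0, by simp, by simp, rfl⟩
    · rintro b ⟨Rh₁, Rh₂, h1, h2, rfl⟩
      by_cases hv : Rh₁ - Rh₂ = 0
      · rw [accTwo_eq, hv]
        simp only [inner_zero_left, mul_zero, lt_irrefl, Set.ofPred_false, measure_empty,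
          ENNReal.toReal_zero]
        rw [hA, sub_nonneg, div_le_one Real.pi_pos]
        exact Real.arccos_le_pi _
      · rw [accTwo_angle _ _ _ _ (by simpa using hw0) hv, sub_zero, hA, ← hwn]
        have hle := upper_comb d w (Rh₁ - Rh₂) hw (by
          intro i
          rcases h1 i with h | h <;> rcases h2 i with hh | hh <;> simp [h, hh])
        have hvn : 0 < ‖Rh₁ - Rh₂‖ := norm_pos_iff.mpr hv
        have hwp : 0 < ‖w‖ := norm_pos_iff.mpr hw0
        have : ⟪w, Rh₁ - Rh₂⟫ / (‖w‖ * ‖Rh₁ - Rh₂‖) ≤ 1 / ‖w‖ := by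
          rw [div_le_div_iff₀ (by positivity) hwp]
          nlinarith
        have := Real.arccos_le_arccos this
        have := div_le_div_of_nonneg_right this Real.pi_pos.le
        linarith
  apply le_antisymm
  · refine le_trans (csInf_le ⟨A, ?_⟩ ⟨w, 0, ?_, by simp, hw0, rfl⟩) hup
    · rintro a ⟨R₁, R₂, -, -, hne, rfl⟩
      exact hlow R₁ R₂ hne
    · intro i
      exact ⟨wt_nonneg _, wt_le_one _⟩
  · apply le_csInf
    · exact ⟨_, w, 0, fun i => ⟨wt_nonneg _, wt_le_one _⟩, by simp, hw0, rfl⟩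
    · rintro a ⟨R₁, R₂, -, -, hne, rfl⟩
      exact hlow R₁ R₂ hne
end

section
/- The sequence d ↦ 1 − arccos(1/√(Σ_{j=1}^d (√j − √(j−1))²))/π tends to 1/2 as d → ∞. -/
lemma hdc_term_bound (n : ℕ) :
    (1 / 4 : ℝ) * (1 / ((n : ℝ) + 1)) ≤
      (Real.sqrt (((n + 1 : ℕ) : ℝ)) - Real.sqrt (((n + 1 : ℕ) : ℝ) - 1)) ^ 2 := by
  push_cast
  rw [add_sub_cancel_right]
  have hn : (0 : ℝ) ≤ n := Nat.cast_nonneg n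
  have ha := Real.sq_sqrt (show (0 : ℝ) ≤ (n : ℝ) + 1 by positivity)
  have hb := Real.sq_sqrt hn
  have hab : Real.sqrt (n : ℝ) ≤ Real.sqrt ((n : ℝ) + 1) := Real.sqrt_le_sqrt (by linarith)
  have hb0 := Real.sqrt_nonneg (n : ℝ)
  have ha0 : 0 < Real.sqrt ((n : ℝ) + 1) := Real.sqrt_pos.mpr (by positivity)
  set a := Real.sqrt ((n : ℝ) + 1)
  set b := Real.sqrt (n : ℝ)
  rw [← ha]
  have h1 : (a - b) * (a + b) = 1 := by nlinarith
  have h2 : 1 / (2 * a) ≤ a - b := by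
    rw [div_le_iff₀ (by positivity)]
    nlinarith
  calc (1 / 4 : ℝ) * (1 / a ^ 2) = (1 / (2 * a)) ^ 2 := by field_simp; norm_num
    _ ≤ (a - b) ^ 2 := by gcongr

lemma hdc_sum_bound (d : ℕ) :
    (1 / 4 : ℝ) * (∑ i ∈ Finset.range d, 1 / ((i : ℝ) + 1)) ≤
      ∑ j ∈ Finset.Icc 1 d, (Real.sqrt (j : ℝ) - Real.sqrt ((j : ℝ) - 1)) ^ 2 := by
  induction d with
  | zero => simp
  | succ n ih =>
    rw [Finset.sum_range_succ, Finset.sum_Icc_succ_top (by omega), mul_add]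
    exact add_le_add ih (hdc_term_bound n)

/-- The worst-case two-class HDC accuracy
`1 − arccos(1/√(Σ_{j=1}^d (√j − √(j−1))²))/π` tends to `1/2` as `d → ∞`. -/
theorem worst_case_accuracy_tendsto_half :
    Filter.Tendsto (fun d : ℕ =>
      1 - Real.arccos (1 / Real.sqrt (∑ j ∈ Finset.Icc 1 d,
        (Real.sqrt (j : ℝ) - Real.sqrt ((j : ℝ) - 1)) ^ 2)) / Real.pi)
      Filter.atTop (nhds (1 / 2)) := by
  have h1 : Filter.Tendsto (fun d : ℕ => ∑ j ∈ Finset.Icc 1 d,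
      (Real.sqrt (j : ℝ) - Real.sqrt ((j : ℝ) - 1)) ^ 2) Filter.atTop Filter.atTop :=
    Filter.tendsto_atTop_mono hdc_sum_bound
      (Real.tendsto_sum_range_one_div_nat_succ_atTop.const_mul_atTop (by norm_num))
  have h2 := (Real.tendsto_sqrt_atTop.comp h1).const_div_atTop (1 : ℝ)
  have h3 := (Real.continuous_arccos.tendsto 0).comp h2
  have h4 := (h3.div_const Real.pi).const_sub 1
  have h5 : 1 - Real.arccos 0 / Real.pi = 1 / 2 := by
    rw [Real.arccos_zero]
    field_simp [Real.pi_ne_zero]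
    norm_num
  rw [h5] at h4
  exact h4
end

section
/- Let d ≥ 1, let μ_d be the uniform probability measure on the closed unit ball B^d of ℝ^d, and let u, v ∈ ℝ^d be nonzero vectors. Then μ_d{x ∈ B^d : u·x > 0 and v·x > 0} = (1/2)·(1 − arccos(u·v/(‖u‖₂‖v‖₂))/π). -/
open MeasureTheory
open scoped RealInnerProductSpace

lemma mjh_null {d : ℕ} (e : EuclideanSpace ℝ (Fin d)) (he : e ≠ 0) :
    volume {x : EuclideanSpace ℝ (Fin d) | ⟪e, x⟫ = 0} = 0 := by
  have h := Measure.addHaar_submodule (volume : Measure (EuclideanSpace ℝ (Fin d)))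
    (LinearMap.ker (innerSL ℝ e).toLinearMap) (by
      intro h
      have h2 : e ∈ LinearMap.ker (innerSL ℝ e).toLinearMap := by rw [h]; trivial
      have h3 : ⟪e, e⟫ = 0 := by simpa using h2
      exact he (inner_self_eq_zero.mp h3))
  convert h using 2
  ext x
  simp

/-- Rotation by `φ` in the plane of an orthonormal pair. -/
lemma mjh_rot {d : ℕ} (e f : EuclideanSpace ℝ (Fin d)) (he : ‖e‖ = 1) (hf : ‖f‖ = 1)
    (hef : ⟪e, f⟫ = 0) (φ : ℝ) :
    ∃ R : EuclideanSpace ℝ (Fin d) ≃ₗᵢ[ℝ] EuclideanSpace ℝ (Fin d), ∀ x,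
      ⟪e, R x⟫ = Real.cos φ * ⟪e, x⟫ - Real.sin φ * ⟪f, x⟫ ∧
      ⟪f, R x⟫ = Real.sin φ * ⟪e, x⟫ + Real.cos φ * ⟪f, x⟫ := by
  have hee : ⟪e, e⟫ = 1 := by rw [real_inner_self_eq_norm_sq, he]; norm_num
  have hff : ⟪f, f⟫ = 1 := by rw [real_inner_self_eq_norm_sq, hf]; norm_num
  have hfe : ⟪f, e⟫ = 0 := by rw [real_inner_comm]; exact hef
  let L : EuclideanSpace ℝ (Fin d) →ₗ[ℝ] EuclideanSpace ℝ (Fin d) :=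
    { toFun := fun x => x + ((Real.cos φ - 1) * ⟪e, x⟫ - Real.sin φ * ⟪f, x⟫) • e
        + (Real.sin φ * ⟪e, x⟫ + (Real.cos φ - 1) * ⟪f, x⟫) • f
      map_add' := by
        intro x y
        simp only [inner_add_right]
        module
      map_smul' := by
        intro c x
        simp only [inner_smul_right, RingHom.id_apply]
        module }
  have hL : ∀ x, L x = x + ((Real.cos φ - 1) * ⟪e, x⟫ - Real.sin φ * ⟪f, x⟫) • e
        + (Real.sin φ * ⟪e, x⟫ + (Real.cos φ - 1) * ⟪f, x⟫) • f := fun x => rfl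
  have hn : ∀ x, ‖L x‖ = ‖x‖ := by
    intro x
    have : ‖L x‖ ^ 2 = ‖x‖ ^ 2 := by
      rw [← real_inner_self_eq_norm_sq, ← real_inner_self_eq_norm_sq, hL]
      simp only [inner_add_right, inner_add_left, real_inner_smul_left, real_inner_smul_right,
        hee, hff, hef, hfe, real_inner_comm e x, real_inner_comm f x]
      rw [real_inner_comm x e, real_inner_comm x f]
      have := Real.sin_sq_add_cos_sq φ
      grind
    exact (sq_eq_sq₀ (norm_nonneg _) (norm_nonneg _)).mp this
  let I : EuclideanSpace ℝ (Fin d) →ₗᵢ[ℝ] EuclideanSpace ℝ (Fin d) := ⟨L, hn⟩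
  refine ⟨I.toLinearIsometryEquiv rfl, fun x => ?_⟩
  have : I.toLinearIsometryEquiv rfl x = L x := rfl
  rw [this, hL]
  simp only [inner_add_right, real_inner_smul_right, hee, hff, hef, hfe]
  constructor <;> ring

lemma mjh_arc0 (θ : ℝ) (h0 : 0 ≤ θ) (h1 : θ ≤ Real.pi) :
    {φ : ℝ | 0 < Real.cos φ ∧ 0 < Real.cos (φ - θ)} ∩ Set.Ioc (-Real.pi) Real.pi
      = Set.Ioo (θ - Real.pi / 2) (Real.pi / 2) := by
  have hpi := Real.pi_pos
  ext φ
  simp only [Set.mem_inter_iff, Set.mem_ofPred_eq, Set.mem_Ioc, Set.mem_Ioo]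
  constructor
  · rintro ⟨⟨h2, h3⟩, h4, h5⟩
    have h6 : φ < Real.pi / 2 := by
      by_contra h
      exact absurd h2 (not_lt.mpr (Real.cos_nonpos_of_pi_div_two_le_of_le (by linarith) (by linarith)))
    refine ⟨?_, h6⟩
    by_contra h
    have h7 : -(Real.pi / 2) < φ := by
      by_contra h
      have := Real.cos_nonpos_of_pi_div_two_le_of_le (x := -φ) (by linarith) (by linarith)
      rw [Real.cos_neg] at this
      linarith
    have := Real.cos_nonpos_of_pi_div_two_le_of_le (x := -(φ - θ)) (by linarith) (by linarith)
    rw [Real.cos_neg] at this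
    linarith
  · rintro ⟨h2, h3⟩
    exact ⟨⟨Real.cos_pos_of_mem_Ioo ⟨by linarith, by linarith⟩,
      Real.cos_pos_of_mem_Ioo ⟨by linarith, by linarith⟩⟩, by linarith, by linarith⟩

lemma mjh_meas (θ α : ℝ) :
    MeasurableSet {φ : ℝ | 0 < Real.cos (φ + α) ∧ 0 < Real.cos (φ + α - θ)} := by
  exact ((isOpen_lt continuous_const (by fun_prop)).and
      (isOpen_lt continuous_const (by fun_prop))).measurableSet

lemma mjh_arc (θ α : ℝ) (h0 : 0 ≤ θ) (h1 : θ ≤ Real.pi) :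
    volume ({φ : ℝ | 0 < Real.cos (φ + α) ∧ 0 < Real.cos (φ + α - θ)} ∩
      Set.Ioc (-Real.pi) Real.pi) = ENNReal.ofReal (Real.pi - θ) := by
  have hpi := Real.pi_pos
  set S : Set ℝ := {φ : ℝ | 0 < Real.cos φ ∧ 0 < Real.cos (φ - θ)} with hS
  have hSm : MeasurableSet S := by
    have := mjh_meas θ 0
    simp only [add_zero] at this
    exact this
  have hTm := mjh_meas θ α
  let h : ℝ → ℝ := S.indicator 1
  have hper : Function.Periodic h (2 * Real.pi) := by
    intro x
    have e : x + 2 * Real.pi - θ = (x - θ) + 2 * Real.pi := by ring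
    simp only [h, Set.indicator, hS, Set.mem_ofPred_eq, e, Real.cos_add_two_pi, Pi.one_apply]
  have key : ∫ φ in (-Real.pi)..Real.pi, h (φ + α) = ∫ φ in (-Real.pi)..Real.pi, h φ := by
    rw [intervalIntegral.integral_comp_add_right]
    have := hper.intervalIntegral_add_eq (-Real.pi + α) (-Real.pi)
    convert this using 2 <;> ring
  have l1 : ∫ φ in (-Real.pi)..Real.pi, h φ = Real.pi - θ := by
    rw [intervalIntegral.integral_of_le (by linarith), integral_indicator_one hSm,
      measureReal_restrict_apply hSm, mjh_arc0 θ h0 h1, Real.volume_real_Ioo_of_le (by linarith)]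
    ring
  have l2 : ∫ φ in (-Real.pi)..Real.pi, h (φ + α) =
      volume.real ({φ : ℝ | 0 < Real.cos (φ + α) ∧ 0 < Real.cos (φ + α - θ)} ∩
      Set.Ioc (-Real.pi) Real.pi) := by
    rw [intervalIntegral.integral_of_le (by linarith), ← measureReal_restrict_apply hTm,
      ← integral_indicator_one hTm]
    rfl
  rw [← l1, ← key, l2, ofReal_measureReal
    ((measure_mono Set.inter_subset_right).trans_lt (by simp)).ne]

lemma mjh_arc2 (θ a b : ℝ) (h0 : 0 ≤ θ) (h1 : θ ≤ Real.pi) (ha : a ≠ 0) :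
    volume ({φ : ℝ | 0 < Real.cos φ * a - Real.sin φ * b ∧
      0 < Real.cos (φ - θ) * a - Real.sin (φ - θ) * b} ∩
      Set.Ioc (-Real.pi) Real.pi) = ENNReal.ofReal (Real.pi - θ) := by
  set z : ℂ := ⟨a, b⟩ with hz
  have hz0 : z ≠ 0 := fun h => ha (by simpa [hz] using congrArg Complex.re h)
  have hr : 0 < ‖z‖ := norm_pos_iff.mpr hz0
  have e1 : a = ‖z‖ * Real.cos z.arg := by rw [Complex.norm_mul_cos_arg]
  have e2 : b = ‖z‖ * Real.sin z.arg := by rw [Complex.norm_mul_sin_arg]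
  rw [← mjh_arc θ z.arg h0 h1]
  congr 2
  ext φ
  have k : ∀ t, Real.cos t * a - Real.sin t * b = ‖z‖ * Real.cos (t + z.arg) := by
    intro t
    rw [Real.cos_add]
    linear_combination Real.cos t * e1 - Real.sin t * e2
  simp only [Set.mem_ofPred_eq, k, mul_pos_iff_of_pos_left hr]
  rw [show φ - θ + z.arg = φ + z.arg - θ by ring]

lemma mjh_core {d : ℕ} (e f : EuclideanSpace ℝ (Fin d)) (he : ‖e‖ = 1) (hf : ‖f‖ = 1)
    (hef : ⟪e, f⟫ = 0) (θ : ℝ) (h0 : 0 ≤ θ) (h1 : θ ≤ Real.pi) :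
    ENNReal.ofReal (2 * Real.pi) * volume ({x : EuclideanSpace ℝ (Fin d) |
      0 < ⟪e, x⟫ ∧ 0 < Real.cos θ * ⟪e, x⟫ + Real.sin θ * ⟪f, x⟫} ∩ Metric.closedBall 0 1)
    = ENNReal.ofReal (Real.pi - θ) *
      volume (Metric.closedBall (0 : EuclideanSpace ℝ (Fin d)) 1) := by
  set B := Metric.closedBall (0 : EuclideanSpace ℝ (Fin d)) 1 with hB
  set S := {x : EuclideanSpace ℝ (Fin d) |
      0 < ⟪e, x⟫ ∧ 0 < Real.cos θ * ⟪e, x⟫ + Real.sin θ * ⟪f, x⟫} with hS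
  let T : Set (ℝ × EuclideanSpace ℝ (Fin d)) :=
    {p | 0 < Real.cos p.1 * ⟪e, p.2⟫ - Real.sin p.1 * ⟪f, p.2⟫ ∧
      0 < Real.cos (p.1 - θ) * ⟪e, p.2⟫ - Real.sin (p.1 - θ) * ⟪f, p.2⟫}
  have hT : MeasurableSet T := by
    exact ((isOpen_lt continuous_const (by fun_prop)).and
      (isOpen_lt continuous_const (by fun_prop))).measurableSet
  have hSm : MeasurableSet S := by
    exact ((isOpen_lt continuous_const (by fun_prop)).and
      (isOpen_lt continuous_const (by fun_prop))).measurableSet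
  have hBm : MeasurableSet B := Metric.isClosed_closedBall.measurableSet
  have A1 := Measure.prod_apply (μ := (volume : Measure ℝ).restrict (Set.Ioc (-Real.pi) Real.pi))
    (ν := (volume : Measure (EuclideanSpace ℝ (Fin d))).restrict B) hT
  have A2 := Measure.prod_apply_symm
    (μ := (volume : Measure ℝ).restrict (Set.Ioc (-Real.pi) Real.pi))
    (ν := (volume : Measure (EuclideanSpace ℝ (Fin d))).restrict B) hT
  rw [A1] at A2
  have L1 : ∀ φ : ℝ, (volume : Measure (EuclideanSpace ℝ (Fin d))).restrict B (Prod.mk φ ⁻¹' T)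
      = volume (S ∩ B) := by
    intro φ
    obtain ⟨R, hR⟩ := mjh_rot e f he hf hef φ
    rw [Measure.restrict_apply (measurable_prodMk_left hT),
      ← R.measurePreserving.measure_preimage (hSm.inter hBm).nullMeasurableSet]
    congr 1
    ext x
    have e1 : Real.cos (φ - θ) * ⟪e, x⟫ - Real.sin (φ - θ) * ⟪f, x⟫ =
      Real.cos θ * (Real.cos φ * ⟪e, x⟫ - Real.sin φ * ⟪f, x⟫) +
        Real.sin θ * (Real.sin φ * ⟪e, x⟫ + Real.cos φ * ⟪f, x⟫) := by
      rw [Real.cos_sub, Real.sin_sub]; ring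
    simp only [T, hS, hB, Set.mem_inter_iff, Set.mem_preimage, Set.mem_ofPred_eq, e1, (hR x).1,
      (hR x).2, mem_closedBall_zero_iff, LinearIsometryEquiv.norm_map]
  have L2 : ∀ᵐ x ∂((volume : Measure (EuclideanSpace ℝ (Fin d))).restrict B),
      (volume : Measure ℝ).restrict (Set.Ioc (-Real.pi) Real.pi) ((fun φ => (φ, x)) ⁻¹' T)
        = ENNReal.ofReal (Real.pi - θ) := by
    apply ae_restrict_of_ae
    have hn := mjh_null e (by intro h; simp [h] at he)
    have : ∀ᵐ x : EuclideanSpace ℝ (Fin d), ⟪e, x⟫ ≠ 0 := by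
      rw [ae_iff]; simpa using hn
    filter_upwards [this] with x hx
    rw [Measure.restrict_apply (measurable_prodMk_right hT)]
    exact mjh_arc2 θ ⟪e, x⟫ ⟪f, x⟫ h0 h1 hx
  rw [lintegral_congr L1, lintegral_congr_ae L2] at A2
  simp only [lintegral_const, Measure.restrict_apply MeasurableSet.univ, Set.univ_inter,
    Real.volume_Ioc] at A2
  rw [← A2, mul_comm]
  congr 2
  ring

lemma mjh_half {d : ℕ} (u : EuclideanSpace ℝ (Fin d)) (hu : u ≠ 0) :
    2 * volume ({x : EuclideanSpace ℝ (Fin d) | 0 < ⟪u, x⟫} ∩ Metric.closedBall 0 1)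
    = volume (Metric.closedBall (0 : EuclideanSpace ℝ (Fin d)) 1) := by
  set B := Metric.closedBall (0 : EuclideanSpace ℝ (Fin d)) 1 with hB
  have hP : MeasurableSet {x : EuclideanSpace ℝ (Fin d) | 0 < ⟪u, x⟫} :=
    (isOpen_lt continuous_const (by fun_prop)).measurableSet
  have hBm : MeasurableSet B := Metric.isClosed_closedBall.measurableSet
  have e1 : volume (B \ {x : EuclideanSpace ℝ (Fin d) | 0 < ⟪u, x⟫}) =
      volume ({x : EuclideanSpace ℝ (Fin d) | 0 < ⟪u, x⟫} ∩ B) := by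
    rw [← (Measure.measurePreserving_neg (volume : Measure (EuclideanSpace ℝ (Fin d)))).measure_preimage
      (hP.inter hBm).nullMeasurableSet]
    apply measure_congr
    have : ∀ᵐ x : EuclideanSpace ℝ (Fin d), ⟪u, x⟫ ≠ 0 := by
      rw [ae_iff]; simpa using mjh_null u hu
    filter_upwards [this] with x hx
    apply propext
    change (x ∈ B ∧ ¬ (0 < ⟪u, x⟫)) ↔ (0 < ⟪u, -x⟫ ∧ -x ∈ B)
    have : -x ∈ B ↔ x ∈ B := by simp [hB]
    rw [this, inner_neg_right]
    constructor
    · rintro ⟨a, b⟩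
      exact ⟨by have := lt_of_le_of_ne (not_lt.mp b) hx; linarith, a⟩
    · rintro ⟨a, b⟩
      exact ⟨b, by linarith⟩
  have := measure_inter_add_sdiff (μ := volume) B hP
  rw [e1, Set.inter_comm] at this
  rw [two_mul, this]

lemma mjh_main {d : ℕ} (u v : EuclideanSpace ℝ (Fin d)) (hu : u ≠ 0) (hv : v ≠ 0) :
    ENNReal.ofReal (2 * Real.pi) * volume ({x : EuclideanSpace ℝ (Fin d) |
      ⟪u, x⟫ > 0 ∧ ⟪v, x⟫ > 0} ∩ Metric.closedBall 0 1)
    = ENNReal.ofReal (Real.pi - InnerProductGeometry.angle u v) *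
      volume (Metric.closedBall (0 : EuclideanSpace ℝ (Fin d)) 1) := by
  have hpi := Real.pi_pos
  have hnu := norm_pos_iff.mpr hu
  have hnv := norm_pos_iff.mpr hv
  rcases eq_or_ne (InnerProductGeometry.angle u v) 0 with h | h
  · obtain ⟨-, r, hr, rfl⟩ := InnerProductGeometry.angle_eq_zero_iff.mp h
    rw [h, sub_zero, ← mjh_half u hu, ← mul_assoc]
    congr 1
    · rw [mul_comm, ENNReal.ofReal_mul hpi.le]; simp
    · congr 2
      ext x
      simp [real_inner_smul_left, hr]
  rcases eq_or_ne (InnerProductGeometry.angle u v) Real.pi with h' | h'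
  · obtain ⟨-, r, hr, rfl⟩ := InnerProductGeometry.angle_eq_pi_iff.mp h'
    rw [h']
    have : {x : EuclideanSpace ℝ (Fin d) | ⟪u, x⟫ > 0 ∧ ⟪r • u, x⟫ > 0} = ∅ := by
      ext x
      simp only [real_inner_smul_left, Set.mem_ofPred_eq, Set.mem_empty_iff_false, iff_false]
      rintro ⟨a, b⟩
      nlinarith
    simp [this]
  set θ := InnerProductGeometry.angle u v with hθ
  have h0 : 0 ≤ θ := InnerProductGeometry.angle_nonneg u v
  have h1 : θ ≤ Real.pi := InnerProductGeometry.angle_le_pi u v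
  have hs : 0 < Real.sin θ :=
    Real.sin_pos_of_pos_of_lt_pi (lt_of_le_of_ne h0 h.symm) (lt_of_le_of_ne h1 h')
  have hc : Real.cos θ * (‖u‖ * ‖v‖) = ⟪u, v⟫ := InnerProductGeometry.cos_angle_mul_norm_mul_norm u v
  have hsc := Real.sin_sq_add_cos_sq θ
  set e := ‖u‖⁻¹ • u with he
  set w := ‖v‖⁻¹ • v with hw
  have hue : u = ‖u‖ • e := by rw [he, smul_smul, mul_inv_cancel₀ hnu.ne', one_smul]
  have hvw : v = ‖v‖ • w := by rw [hw, smul_smul, mul_inv_cancel₀ hnv.ne', one_smul]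
  have hen : ‖e‖ = 1 := by rw [he, norm_smul, norm_inv, norm_norm, inv_mul_cancel₀ hnu.ne']
  have hwn : ‖w‖ = 1 := by rw [hw, norm_smul, norm_inv, norm_norm, inv_mul_cancel₀ hnv.ne']
  have hew : ⟪e, w⟫ = Real.cos θ := by
    rw [he, hw, real_inner_smul_left, real_inner_smul_right, ← hc]
    field_simp
  have hee : ⟪e, e⟫ = 1 := by rw [real_inner_self_eq_norm_sq, hen]; norm_num
  have hww : ⟪w, w⟫ = 1 := by rw [real_inner_self_eq_norm_sq, hwn]; norm_num
  have hwe : ⟪w, e⟫ = Real.cos θ := by rw [real_inner_comm]; exact hew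
  clear_value e w
  set f := (Real.sin θ)⁻¹ • (w - Real.cos θ • e) with hf
  have hef : ⟪e, f⟫ = 0 := by
    rw [hf, real_inner_smul_right, inner_sub_right, real_inner_smul_right, hee, hew]; ring
  have hfn : ‖f‖ = 1 := by
    have : ‖f‖ ^ 2 = 1 := by
      rw [← real_inner_self_eq_norm_sq, hf]
      simp only [real_inner_smul_right, real_inner_smul_left, inner_sub_right, inner_sub_left,
        hee, hew, hww, hwe]
      field_simp
      linarith
    have h3 := norm_nonneg f
    nlinarith
  have hwf : w = Real.cos θ • e + Real.sin θ • f := by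
    rw [hf, smul_smul, mul_inv_cancel₀ hs.ne', one_smul]; abel
  clear_value f
  rw [← mjh_core e f hen hfn hef θ h0 h1]
  congr 3
  ext x
  have a1 : ⟪u, x⟫ = ‖u‖ * ⟪e, x⟫ := by
    conv_lhs => rw [hue]
    rw [real_inner_smul_left]
  have a2 : ⟪v, x⟫ = ‖v‖ * (Real.cos θ * ⟪e, x⟫ + Real.sin θ * ⟪f, x⟫) := by
    conv_lhs => rw [hvw, hwf]
    rw [real_inner_smul_left, inner_add_left, real_inner_smul_left, real_inner_smul_left]
  simp only [Set.mem_ofPred_eq, a1, a2, gt_iff_lt, mul_pos_iff_of_pos_left hnu,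
    mul_pos_iff_of_pos_left hnv]

/-- Lemma 1 of the paper: for nonzero `u, v`,
`μ_d{x : u·x > 0 ∧ v·x > 0} = (1/2)(1 − arccos(u·v/(‖u‖‖v‖))/π)`. -/
theorem measure_joint_halfspaces (d : ℕ) (hd : 1 ≤ d)
    (u v : EuclideanSpace ℝ (Fin d)) (hu : u ≠ 0) (hv : v ≠ 0) :
    (unifBall d {x | ⟪u, x⟫ > 0 ∧ ⟪v, x⟫ > 0}).toReal =
      (1 / 2) * (1 - Real.arccos (⟪u, v⟫ / (‖u‖ * ‖v‖)) / Real.pi) := by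
  have hpi := Real.pi_pos
  have hm := congrArg ENNReal.toReal (mjh_main u v hu hv)
  have hang : Real.arccos (⟪u, v⟫ / (‖u‖ * ‖v‖)) = InnerProductGeometry.angle u v := rfl
  have h1 := InnerProductGeometry.angle_le_pi u v
  have hS : MeasurableSet {x : EuclideanSpace ℝ (Fin d) | ⟪u, x⟫ > 0 ∧ ⟪v, x⟫ > 0} := by
    exact ((isOpen_lt continuous_const (by fun_prop)).and
      (isOpen_lt continuous_const (by fun_prop))).measurableSet
  have hV : 0 < (volume (Metric.closedBall (0 : EuclideanSpace ℝ (Fin d)) 1)).toReal :=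
    ENNReal.toReal_pos (Metric.measure_closedBall_pos _ _ one_pos).ne'
      measure_closedBall_lt_top.ne
  rw [ENNReal.toReal_mul, ENNReal.toReal_mul, ENNReal.toReal_ofReal (by linarith),
    ENNReal.toReal_ofReal (by linarith)] at hm
  rw [hang, unifBall, Measure.smul_apply, Measure.restrict_apply hS, smul_eq_mul,
    ENNReal.toReal_mul, ENNReal.toReal_inv]
  field_simp
  linarith
end

section
/- Let d ≥ 1 and let Δθ ∈ ℝ^d be a nonzero vector whose coordinates are ordered by absolute value: |Δθ₁| ≥ |Δθ₂| ≥ … ≥ |Δθ_d|. Then the supremum over nonzero Δθ̂ ∈ {−1,0,1}^d of (Δθ·Δθ̂)/(‖Δθ‖₂‖Δθ̂‖₂) equals the maximum over 1 ≤ j ≤ d of (Σ_{i=1}^j |Δθ_i|)/(√j·‖Δθ‖₂). -/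
open scoped RealInnerProductSpace

lemma top_sum_aux (d : ℕ) (a : Fin d → ℝ) (hord : ∀ i j : Fin d, i ≤ j → a j ≤ a i)
    (S : Finset (Fin d)) (hS : S.Nonempty) :
    ∑ i ∈ S, a i ≤ ∑ i ∈ Finset.univ.filter (fun i : Fin d => (i : ℕ) < S.card), a i := by
  have h1 : 1 ≤ S.card := hS.card_pos
  have h2 : S.card ≤ d := by simpa using S.card_le_univ
  have hF : (Finset.univ.filter (fun i : Fin d => (i : ℕ) < S.card)).card = S.card := by
    rw [Fin.card_filter_val_lt]; omega
  set F := Finset.univ.filter (fun i : Fin d => (i : ℕ) < S.card) with hFdef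
  let c := a ⟨S.card - 1, by omega⟩
  have key : ∑ i ∈ S, (a i - c) ≤ ∑ i ∈ F, (a i - c) := by
    calc ∑ i ∈ S, (a i - c) ≤ ∑ i ∈ S, max (a i - c) 0 :=
          Finset.sum_le_sum fun i _ => le_max_left _ _
      _ ≤ ∑ i, max (a i - c) 0 :=
          Finset.sum_le_sum_of_subset_of_nonneg (Finset.subset_univ _)
            fun i _ _ => le_max_right _ _
      _ = ∑ i ∈ F, (a i - c) := by
          rw [hFdef, Finset.sum_filter]
          refine Finset.sum_congr rfl fun i _ => ?_
          split_ifs with h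
          · apply max_eq_left
            have := hord i ⟨S.card - 1, by omega⟩ (by rw [Fin.le_def]; simp only; omega)
            simp only [c]; linarith
          · apply max_eq_right
            have := hord ⟨S.card - 1, by omega⟩ i (by rw [Fin.le_def]; simp only; omega)
            simp only [c]; linarith
  simp only [Finset.sum_sub_distrib, Finset.sum_const, hF] at key
  linarith

lemma norm_tern_aux (d : ℕ) (t : EuclideanSpace ℝ (Fin d))
    (ht : ∀ i, t i = -1 ∨ t i = 0 ∨ t i = 1) :
    ‖t‖ = Real.sqrt ((Finset.univ.filter (fun i => t i ≠ 0)).card : ℝ) := by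
  rw [EuclideanSpace.norm_eq, Finset.card_filter]
  congr 1
  push_cast
  refine Finset.sum_congr rfl fun i _ => ?_
  rcases ht i with h | h | h <;> simp [h]

/-- Lemma 2 of the paper: for a nonzero `Δθ ∈ ℝ^d` with coordinates ordered by absolute
value, the supremum over nonzero `Δθ̂ ∈ {−1,0,1}^d` of `(Δθ·Δθ̂)/(‖Δθ‖‖Δθ̂‖)` equals the
maximum over `1 ≤ j ≤ d` of `(Σ_{i=1}^j |Δθ_i|)/(√j ‖Δθ‖)`. -/
theorem sup_cosine_binary_eq_max_partial_sums (d : ℕ) (hd : 1 ≤ d)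
    (θ : EuclideanSpace ℝ (Fin d)) (hθ : θ ≠ 0)
    (hord : ∀ i j : Fin d, i ≤ j → |θ j| ≤ |θ i|) :
    sSup {c : ℝ | ∃ t : EuclideanSpace ℝ (Fin d),
        (∀ i, t i = -1 ∨ t i = 0 ∨ t i = 1) ∧ t ≠ 0 ∧
        c = ⟪θ, t⟫ / (‖θ‖ * ‖t‖)} =
    sSup {c : ℝ | ∃ j ∈ Finset.Icc 1 d,
        c = (∑ i ∈ Finset.univ.filter (fun i : Fin d => (i : ℕ) < j), |θ i|)
            / (Real.sqrt (j : ℝ) * ‖θ‖)} := by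
  have hθ0 : 0 < ‖θ‖ := norm_pos_iff.mpr hθ
  set A := {c : ℝ | ∃ t : EuclideanSpace ℝ (Fin d),
        (∀ i, t i = -1 ∨ t i = 0 ∨ t i = 1) ∧ t ≠ 0 ∧
        c = ⟪θ, t⟫ / (‖θ‖ * ‖t‖)} with hA
  set B := {c : ℝ | ∃ j ∈ Finset.Icc 1 d,
        c = (∑ i ∈ Finset.univ.filter (fun i : Fin d => (i : ℕ) < j), |θ i|)
            / (Real.sqrt (j : ℝ) * ‖θ‖)} with hB
  have hBA : B ⊆ A := by
    rintro c ⟨j, hj, rfl⟩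
    rw [Finset.mem_Icc] at hj
    let t : EuclideanSpace ℝ (Fin d) := WithLp.toLp 2
      (fun i : Fin d => if (i : ℕ) < j then (if θ i < 0 then (-1 : ℝ) else 1) else 0)
    have hti : ∀ i, t i = if (i : ℕ) < j then (if θ i < 0 then (-1 : ℝ) else 1) else 0 :=
      fun i => rfl
    have ht : ∀ i, t i = -1 ∨ t i = 0 ∨ t i = 1 := by
      intro i; rw [hti]; split_ifs <;> simp
    have hsupp : (Finset.univ.filter (fun i => t i ≠ 0)).card = j := by
      have : Finset.univ.filter (fun i => t i ≠ 0)
          = Finset.univ.filter (fun i : Fin d => (i : ℕ) < j) := by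
        ext i
        simp only [Finset.mem_filter, Finset.mem_univ, true_and, hti]
        split_ifs <;> simp_all
      rw [this, Fin.card_filter_val_lt]; omega
    have hn := norm_tern_aux d t ht
    rw [hsupp] at hn
    refine ⟨t, ht, ?_, ?_⟩
    · intro h0
      have : t ⟨0, by omega⟩ = 0 := by rw [h0]; rfl
      rw [hti, if_pos (by simp only; omega)] at this
      split_ifs at this <;> norm_num at this
    · rw [hn, mul_comm ‖θ‖]
      congr 1
      rw [PiLp.inner_apply, Finset.sum_filter]
      refine Finset.sum_congr rfl fun i _ => ?_
      simp only [hti]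
      split_ifs with h1 h2
      · simp [abs_of_neg h2]
      · simp [abs_of_nonneg (not_lt.mp h2)]
      · simp
  have hAB : ∀ c ∈ A, ∃ b ∈ B, c ≤ b := by
    rintro c ⟨t, ht, ht0, rfl⟩
    have hS : (Finset.univ.filter (fun i => t i ≠ 0)).Nonempty := by
      by_contra h
      rw [Finset.not_nonempty_iff_eq_empty, Finset.filter_eq_empty_iff] at h
      apply ht0
      ext i
      simpa using h (Finset.mem_univ i)
    have hn := norm_tern_aux d t ht
    have hs := top_sum_aux d (fun i => |θ i|) hord _ hS
    have hle : (Finset.univ.filter (fun i => t i ≠ 0)).card ≤ d := by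
      simpa using Finset.card_le_univ (Finset.univ.filter (fun i => t i ≠ 0))
    refine ⟨_, ⟨_, Finset.mem_Icc.mpr ⟨hS.card_pos, hle⟩, rfl⟩, ?_⟩
    rw [hn, mul_comm ‖θ‖]
    refine div_le_div_of_nonneg_right (le_trans ?_ hs) (by positivity)
    rw [PiLp.inner_apply, Finset.sum_filter]
    refine Finset.sum_le_sum fun i _ => ?_
    rcases ht i with h | h | h
    · simp [h, neg_le_abs]
    · simp [h]
    · simp [h, le_abs_self]
  have hBfin : B.Finite := by
    refine ((Finset.Icc 1 d).finite_toSet.image (fun j : ℕ =>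
      (∑ i ∈ Finset.univ.filter (fun i : Fin d => (i : ℕ) < j), |θ i|)
            / (Real.sqrt (j : ℝ) * ‖θ‖))).subset ?_
    rintro c ⟨j, hj, rfl⟩
    exact ⟨j, hj, rfl⟩
  have hBne : B.Nonempty := ⟨_, 1, Finset.mem_Icc.mpr ⟨le_refl _, hd⟩, rfl⟩
  have hub : ∀ c ∈ A, c ≤ sSup B := by
    intro c hc
    obtain ⟨b, hb, hcb⟩ := hAB c hc
    exact hcb.trans (le_csSup hBfin.bddAbove hb)
  exact le_antisymm (csSup_le (hBne.mono hBA) hub)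
    (csSup_le_csSup ⟨_, hub⟩ hBne hBA)
end

section
/- For every integer d ≥ 1, the infimum over θ₁, θ₂ ∈ [0,1]^d with θ₁ ≠ θ₂ of the supremum over θ̂₁, θ̂₂ ∈ {0,1}^d with θ̂₁ ≠ θ̂₂ of the quantity 1 − arccos(((θ₁−θ₂)·(θ̂₁−θ̂₂))/(‖θ₁−θ₂‖₂‖θ̂₁−θ̂₂‖₂))/π is at most 1 − arccos(1/√(Σ_{j=1}^d (√j − √(j−1))²))/π. -/
open scoped RealInnerProductSpace


lemma sqrt_diff_anti (n a : ℕ) (h : n ≤ a) :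
    Real.sqrt ((a : ℝ) + 1) - Real.sqrt (a : ℝ) ≤ Real.sqrt ((n : ℝ) + 1) - Real.sqrt (n : ℝ) := by
  have h' : (n : ℝ) ≤ a := by exact_mod_cast h
  have hn : (0 : ℝ) ≤ n := Nat.cast_nonneg n
  have ha : (0 : ℝ) ≤ a := Nat.cast_nonneg a
  have h1 := Real.sqrt_le_sqrt (show (n : ℝ) + 1 ≤ a + 1 by linarith)
  have h2 := Real.sqrt_le_sqrt h'
  have h3 := Real.sqrt_le_sqrt (show (n : ℝ) ≤ n + 1 by linarith)
  have e1 := Real.sq_sqrt (show (0 : ℝ) ≤ (a : ℝ) + 1 by linarith)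
  have e2 := Real.sq_sqrt ha
  have e3 := Real.sq_sqrt (show (0 : ℝ) ≤ (n : ℝ) + 1 by linarith)
  have e4 := Real.sq_sqrt hn
  have p1 : 0 < Real.sqrt ((n : ℝ) + 1) := Real.sqrt_pos.2 (by linarith)
  have p2 := Real.sqrt_nonneg (n : ℝ)
  generalize Real.sqrt ((a : ℝ) + 1) = x at *
  generalize Real.sqrt (a : ℝ) = y at *
  generalize Real.sqrt ((n : ℝ) + 1) = p at *
  generalize Real.sqrt (n : ℝ) = q at *
  by_contra! hc
  have k1 : (p - q) * (p + q) < (x - y) * (p + q) := mul_lt_mul_of_pos_right hc (by linarith)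
  have k2 : (x - y) * (p + q) ≤ (x - y) * (x + y) :=
    mul_le_mul_of_nonneg_left (by linarith) (by linarith)
  nlinarith

lemma sum_sqrt_diff_le (s : Finset ℕ) :
    ∑ i ∈ s, (Real.sqrt ((i : ℝ) + 1) - Real.sqrt (i : ℝ)) ≤ Real.sqrt (s.card : ℝ) := by
  induction s using Finset.induction_on_max with
  | empty => simp
  | insert a s hs ih =>
    have hna : a ∉ s := fun h => lt_irrefl _ (hs a h)
    rw [Finset.sum_insert hna, Finset.card_insert_of_notMem hna]
    have hc : s.card ≤ a := by
      have : s ⊆ Finset.range a := fun x hx => Finset.mem_range.2 (hs x hx)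
      simpa using Finset.card_le_card this
    have := sqrt_diff_anti s.card a hc
    push_cast
    linarith

lemma sum_mul_le_norm (d : ℕ) (v w : EuclideanSpace ℝ (Fin d))
    (hv : ∀ i, v i = Real.sqrt (((i : ℕ) : ℝ) + 1) - Real.sqrt ((i : ℕ) : ℝ))
    (hw : ∀ i, w i = 0 ∨ w i = 1 ∨ w i = -1) :
    inner ℝ v w ≤ ‖w‖ := by
  classical
  set S : Finset (Fin d) := Finset.univ.filter (fun i => w i ≠ 0) with hS
  have hvn : ∀ i, 0 ≤ v i := fun i => by
    rw [hv, sub_nonneg]; exact Real.sqrt_le_sqrt (by linarith)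
  have hn : ‖w‖ = Real.sqrt (S.card : ℝ) := by
    rw [EuclideanSpace.norm_eq]
    congr 1
    rw [hS, Finset.card_filter]
    push_cast
    refine Finset.sum_congr rfl fun i _ => ?_
    rcases hw i with h | h | h <;> simp [h]
  have h1 : inner ℝ v w ≤ ∑ i ∈ S, v i := by
    rw [PiLp.inner_apply, hS, Finset.sum_filter]
    refine Finset.sum_le_sum fun i _ => ?_
    have := hvn i
    rcases hw i with h | h | h <;> simp [h]
    linarith
  have h2 := sum_sqrt_diff_le (S.map Fin.valEmbedding)
  rw [Finset.sum_map, Finset.card_map] at h2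
  rw [hn]
  refine h1.trans (le_trans (le_of_eq ?_) h2)
  exact Finset.sum_congr rfl fun i _ => hv i

lemma one_sub_arccos_nonneg (x : ℝ) : 0 ≤ 1 - Real.arccos x / Real.pi := by
  rw [sub_nonneg, div_le_one Real.pi_pos]
  exact Real.arccos_le_pi x

/-- Lemma 3 of the paper: the inf over `θ₁ ≠ θ₂` in the unit cube of the sup over binary
`θ̂₁ ≠ θ̂₂` of `1 − arccos(((θ₁−θ₂)·(θ̂₁−θ̂₂))/(‖θ₁−θ₂‖‖θ̂₁−θ̂₂‖))/π` is at most
`1 − arccos(1/√(Σ_{j=1}^d (√j − √(j−1))²))/π`. -/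
theorem inf_sup_accuracy_le (d : ℕ) (hd : 1 ≤ d) :
    sInf {a : ℝ | ∃ θ₁ θ₂ : EuclideanSpace ℝ (Fin d),
      (∀ i, θ₁ i ∈ Set.Icc (0:ℝ) 1) ∧ (∀ i, θ₂ i ∈ Set.Icc (0:ℝ) 1) ∧ θ₁ ≠ θ₂ ∧
      a = sSup {b : ℝ | ∃ th₁ th₂ : EuclideanSpace ℝ (Fin d),
        (∀ i, th₁ i = 0 ∨ th₁ i = 1) ∧ (∀ i, th₂ i = 0 ∨ th₂ i = 1) ∧ th₁ ≠ th₂ ∧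
        b = 1 - Real.arccos (⟪θ₁ - θ₂, th₁ - th₂⟫ / (‖θ₁ - θ₂‖ * ‖th₁ - th₂‖)) / Real.pi}} ≤
    1 - Real.arccos (1 / Real.sqrt (∑ j ∈ Finset.Icc 1 d,
      (Real.sqrt (j : ℝ) - Real.sqrt ((j : ℝ) - 1)) ^ 2)) / Real.pi := by
  set v : EuclideanSpace ℝ (Fin d) := WithLp.toLp 2
    (fun i : Fin d => Real.sqrt (((i : ℕ) : ℝ) + 1) - Real.sqrt ((i : ℕ) : ℝ)) with hvdef
  have hv : ∀ i, v i = Real.sqrt (((i : ℕ) : ℝ) + 1) - Real.sqrt ((i : ℕ) : ℝ) := fun i => rfl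
  have hnorm : ‖v‖ = Real.sqrt (∑ j ∈ Finset.Icc 1 d,
      (Real.sqrt (j : ℝ) - Real.sqrt ((j : ℝ) - 1)) ^ 2) := by
    rw [EuclideanSpace.norm_eq]
    congr 1
    rw [← Finset.Ico_add_one_right_eq_Icc, Finset.sum_Ico_eq_sum_range, Nat.add_sub_cancel,
      Finset.sum_range]
    refine Finset.sum_congr rfl fun i _ => ?_
    rw [hv, Real.norm_eq_abs, sq_abs]
    push_cast
    rw [add_comm (1 : ℝ), add_sub_cancel_right]
  have hv0 : v ≠ 0 := by
    intro h
    have h0 := hv ⟨0, hd⟩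
    rw [h] at h0
    simp at h0
  rw [← hnorm]
  set B : Set ℝ := {b : ℝ | ∃ th₁ th₂ : EuclideanSpace ℝ (Fin d),
        (∀ i, th₁ i = 0 ∨ th₁ i = 1) ∧ (∀ i, th₂ i = 0 ∨ th₂ i = 1) ∧ th₁ ≠ th₂ ∧
        b = 1 - Real.arccos (⟪v - 0, th₁ - th₂⟫ / (‖v - 0‖ * ‖th₁ - th₂‖)) / Real.pi} with hB
  refine le_trans (b := sSup B) (csInf_le ?_ ⟨v, 0, ?_, ?_, hv0, rfl⟩) ?_
  · refine ⟨0, ?_⟩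
    rintro a ⟨_, _, _, _, _, rfl⟩
    refine Real.sSup_nonneg ?_
    rintro b ⟨_, _, _, _, _, rfl⟩
    exact one_sub_arccos_nonneg _
  · intro i
    rw [hv]
    constructor
    · rw [sub_nonneg]; exact Real.sqrt_le_sqrt (by linarith)
    · have := sqrt_diff_anti 0 i (Nat.zero_le _)
      simpa using this
  · intro i; simp
  · refine Real.sSup_le ?_ (one_sub_arccos_nonneg _)
    rintro b ⟨a, c, ha, hc, hac, rfl⟩
    have hw : 0 < ‖a - c‖ := norm_pos_iff.2 (sub_ne_zero.2 hac)
    have hvp : 0 < ‖v‖ := norm_pos_iff.2 hv0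
    have key := sum_mul_le_norm d v (a - c) hv (fun i => by
      rcases ha i with h | h <;> rcases hc i with h' | h' <;> simp [h, h'])
    rw [sub_zero]
    have : inner ℝ v (a - c) / (‖v‖ * ‖a - c‖) ≤ 1 / ‖v‖ := by
      rw [div_le_div_iff₀ (mul_pos hvp hw) hvp]
      nlinarith
    have := Real.arccos_le_arccos this
    have := div_le_div_of_nonneg_right this Real.pi_pos.le
    linarith
end

section
/- For every integer d ≥ 1, the infimum over θ₁, θ₂ ∈ [0,1]^d with θ₁ ≠ θ₂ of the supremum over θ̂₁, θ̂₂ ∈ {0,1}^d with θ̂₁ ≠ θ̂₂ of the quantity 1 − arccos(((θ₁−θ₂)·(θ̂₁−θ̂₂))/(‖θ₁−θ₂‖₂‖θ̂₁−θ̂₂‖₂))/π is at least 1 − arccos(1/√(Σ_{j=1}^d (√j − √(j−1))²))/π. -/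
open scoped RealInnerProductSpace


lemma abel_aux (a b : ℕ → ℝ) (ha : Antitone a) (n : ℕ)
    (hb : ∀ k ≤ n + 1, 0 ≤ ∑ j ∈ Finset.range k, b j) :
    a n * ∑ j ∈ Finset.range (n + 1), b j ≤ ∑ j ∈ Finset.range (n + 1), a j * b j := by
  induction n with
  | zero => simp
  | succ n ih =>
    have h1 := ih (fun k hk => hb k (by omega))
    have h2 := hb (n + 1) (by omega)
    have h3 := ha (Nat.le_succ n)
    rw [Finset.sum_range_succ, Finset.sum_range_succ (fun j => a j * b j)]
    have := mul_le_mul_of_nonneg_right h3 h2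
    simp only [Nat.succ_eq_add_one] at this
    linarith

lemma key_seq (d : ℕ) (hd : 1 ≤ d) (a : ℕ → ℝ) (ha : Antitone a) (h0 : ∀ j, 0 ≤ a j) :
    ∃ k, 1 ≤ k ∧ k ≤ d ∧ √(∑ j ∈ Finset.range d, a j ^ 2) ≤
      (∑ j ∈ Finset.range k, a j) / √(k : ℝ) *
        √(∑ j ∈ Finset.range d, (√((j : ℝ) + 1) - √(j : ℝ)) ^ 2) := by
  obtain ⟨k, hk, hmax⟩ := Finset.exists_max_image (Finset.Icc 1 d)
    (fun k : ℕ => (∑ j ∈ Finset.range k, a j) / √(k : ℝ)) ⟨1, by simp [hd]⟩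
  rw [Finset.mem_Icc] at hk
  refine ⟨k, hk.1, hk.2, ?_⟩
  set M := (∑ j ∈ Finset.range k, a j) / √(k : ℝ) with hM
  have hM0 : 0 ≤ M := div_nonneg (Finset.sum_nonneg fun j _ => h0 j) (Real.sqrt_nonneg _)
  have hc : ∀ k : ℕ, ∑ j ∈ Finset.range k, (√((j : ℝ) + 1) - √(j : ℝ)) = √(k : ℝ) := by
    intro k
    have := Finset.sum_range_sub (fun j : ℕ => √(j : ℝ)) k
    simpa using this
  have hS : ∀ m ≤ d, 0 ≤ ∑ j ∈ Finset.range m, (M * (√((j : ℝ) + 1) - √(j : ℝ)) - a j) := by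
    intro m hm
    rw [Finset.sum_sub_distrib, ← Finset.mul_sum, hc]
    rcases Nat.eq_zero_or_pos m with rfl | hpos
    · simp
    · have := hmax m (Finset.mem_Icc.2 ⟨hpos, hm⟩)
      have hp : 0 < √(m : ℝ) := Real.sqrt_pos.2 (by exact_mod_cast hpos)
      have h := (div_le_iff₀ hp).1 this
      linarith
  obtain ⟨n, rfl⟩ : ∃ n, d = n + 1 := ⟨d - 1, by omega⟩
  have h1 := abel_aux a (fun j => M * (√((j : ℝ) + 1) - √(j : ℝ)) - a j) ha n hS
  have h2 := mul_nonneg (h0 n) (hS (n + 1) le_rfl)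
  have h3 : ∑ j ∈ Finset.range (n + 1), a j * (M * (√((j : ℝ) + 1) - √(j : ℝ)) - a j)
      = M * ∑ j ∈ Finset.range (n + 1), a j * (√((j : ℝ) + 1) - √(j : ℝ))
        - ∑ j ∈ Finset.range (n + 1), a j ^ 2 := by
    rw [Finset.mul_sum, ← Finset.sum_sub_distrib]
    exact Finset.sum_congr rfl fun j _ => by ring
  have h4 := Real.sum_mul_le_sqrt_mul_sqrt (Finset.range (n + 1)) a
    (fun j => √((j : ℝ) + 1) - √(j : ℝ))
  have h5 := mul_le_mul_of_nonneg_left h4 hM0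
  have hA : 0 ≤ ∑ j ∈ Finset.range (n + 1), a j ^ 2 := Finset.sum_nonneg fun j _ => sq_nonneg _
  have h6 := Real.mul_self_sqrt hA
  set A := √(∑ j ∈ Finset.range (n + 1), a j ^ 2)
  set C := √(∑ j ∈ Finset.range (n + 1), (√((j : ℝ) + 1) - √(j : ℝ)) ^ 2)
  have hA0 : 0 ≤ A := Real.sqrt_nonneg _
  have hC0 : 0 ≤ C := Real.sqrt_nonneg _
  rcases hA0.eq_or_lt with h | h
  · rw [← h]; positivity
  · refine le_of_mul_le_mul_left ?_ h
    nlinarith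

lemma key_vec (d : ℕ) (hd : 1 ≤ d) (v : EuclideanSpace ℝ (Fin d)) :
    ∃ th₁ th₂ : EuclideanSpace ℝ (Fin d),
      (∀ i, th₁ i = 0 ∨ th₁ i = 1) ∧ (∀ i, th₂ i = 0 ∨ th₂ i = 1) ∧ th₁ ≠ th₂ ∧
      ‖v‖ ≤ ⟪v, th₁ - th₂⟫ / ‖th₁ - th₂‖ *
        √(∑ j ∈ Finset.range d, (√((j : ℝ) + 1) - √(j : ℝ)) ^ 2) := by
  classical
  set σ := Tuple.sort (fun i => -|v i|) with hσ
  have hmono : Monotone ((fun i => -|v i|) ∘ σ) := Tuple.monotone_sort _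
  set a : ℕ → ℝ := fun j => if h : j < d then |v (σ ⟨j, h⟩)| else 0 with ha
  have h0 : ∀ j, 0 ≤ a j := by
    intro j; simp only [ha]; split_ifs
    · exact abs_nonneg _
    · exact le_rfl
  have hanti : Antitone a := by
    intro i j hij
    by_cases hj : j < d
    · have hi : i < d := by omega
      have := hmono (show (⟨i, hi⟩ : Fin d) ≤ ⟨j, hj⟩ from hij)
      simp only [Function.comp] at this
      simp only [ha, hi, hj, dif_pos]
      linarith
    · have : a j = 0 := by simp [ha, hj]
      rw [this]; exact h0 i
  obtain ⟨k, hk1, hkd, hk⟩ := key_seq d hd a hanti h0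
  have ev : ∀ j : Fin d, a j = |v (σ j)| := fun j => by simp [ha]
  have hsq : √(∑ j ∈ Finset.range d, a j ^ 2) = ‖v‖ := by
    rw [EuclideanSpace.norm_eq, ← Fin.sum_univ_eq_sum_range (fun j => a j ^ 2)]
    congr 1
    rw [← Equiv.sum_comp σ (fun i => ‖v i‖ ^ 2)]
    simp [ev]
  let t₁ : EuclideanSpace ℝ (Fin d) :=
    WithLp.toLp 2 (fun i => if (σ.symm i : ℕ) < k ∧ 0 ≤ v i then 1 else 0)
  let t₂ : EuclideanSpace ℝ (Fin d) :=
    WithLp.toLp 2 (fun i => if (σ.symm i : ℕ) < k ∧ ¬ 0 ≤ v i then 1 else 0)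
  have hcard : ∀ f : ℕ → ℝ, ∑ j : Fin d, (if (j : ℕ) < k then f j else 0)
      = ∑ j ∈ Finset.range k, f j := by
    intro f
    rw [Fin.sum_univ_eq_sum_range (fun j => if j < k then f j else 0), ← Finset.sum_filter]
    congr 1
    ext j; simp; omega
  have hn : ‖t₁ - t₂‖ = √(k : ℝ) := by
    rw [EuclideanSpace.norm_eq]
    congr 1
    rw [← Equiv.sum_comp σ]
    have := hcard (fun _ => 1)
    simp only [Finset.sum_const, Finset.card_range, nsmul_eq_mul, mul_one] at this
    rw [← this]
    refine Finset.sum_congr rfl fun j _ => ?_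
    simp only [t₁, t₂, PiLp.sub_apply, Equiv.symm_apply_apply]
    by_cases h1 : (j : ℕ) < k <;> by_cases h2 : 0 ≤ v (σ j) <;> simp [h1, h2]
  have hin : ⟪v, t₁ - t₂⟫ = ∑ j ∈ Finset.range k, a j := by
    rw [PiLp.inner_apply, ← Equiv.sum_comp σ, ← hcard]
    refine Finset.sum_congr rfl fun j _ => ?_
    rw [ev]
    simp only [t₁, t₂, PiLp.sub_apply, Equiv.symm_apply_apply]
    by_cases h1 : (j : ℕ) < k <;> by_cases h2 : 0 ≤ v (σ j)
    · simp [h1, h2, abs_of_nonneg]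
    · simp [h1, h2, abs_of_neg (not_le.1 h2)]
    · simp [h1, h2]
    · simp [h1, h2]
  refine ⟨t₁, t₂, ?_, ?_, ?_, ?_⟩
  · intro i; simp only [t₁]; split_ifs <;> simp
  · intro i; simp only [t₂]; split_ifs <;> simp
  · intro h
    rw [h, sub_self, norm_zero] at hn
    have : 0 < √(k : ℝ) := Real.sqrt_pos.2 (by exact_mod_cast hk1)
    linarith
  · rw [hn, hin, ← hsq]; exact hk

/-- Lemma 4 of the paper: the inf over `θ₁ ≠ θ₂` in the unit cube of the sup over binary
`θ̂₁ ≠ θ̂₂` of `1 − arccos(((θ₁−θ₂)·(θ̂₁−θ̂₂))/(‖θ₁−θ₂‖‖θ̂₁−θ̂₂‖))/π` is at least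
`1 − arccos(1/√(Σ_{j=1}^d (√j − √(j−1))²))/π`. -/
theorem inf_sup_accuracy_ge (d : ℕ) (hd : 1 ≤ d) :
    sInf {a : ℝ | ∃ θ₁ θ₂ : EuclideanSpace ℝ (Fin d),
      (∀ i, θ₁ i ∈ Set.Icc (0:ℝ) 1) ∧ (∀ i, θ₂ i ∈ Set.Icc (0:ℝ) 1) ∧ θ₁ ≠ θ₂ ∧
      a = sSup {b : ℝ | ∃ th₁ th₂ : EuclideanSpace ℝ (Fin d),
        (∀ i, th₁ i = 0 ∨ th₁ i = 1) ∧ (∀ i, th₂ i = 0 ∨ th₂ i = 1) ∧ th₁ ≠ th₂ ∧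
        b = 1 - Real.arccos (⟪θ₁ - θ₂, th₁ - th₂⟫ / (‖θ₁ - θ₂‖ * ‖th₁ - th₂‖)) / Real.pi}} ≥
    1 - Real.arccos (1 / Real.sqrt (∑ j ∈ Finset.Icc 1 d,
      (Real.sqrt (j : ℝ) - Real.sqrt ((j : ℝ) - 1)) ^ 2)) / Real.pi := by
  have hC : ∑ j ∈ Finset.Icc 1 d, (Real.sqrt (j : ℝ) - Real.sqrt ((j : ℝ) - 1)) ^ 2
      = ∑ j ∈ Finset.range d, (√((j : ℝ) + 1) - √(j : ℝ)) ^ 2 := by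
    have h := Finset.sum_Ico_add' (fun j : ℕ => (√(j : ℝ) - √((j : ℝ) - 1)) ^ 2) 0 d 1
    have hI : Finset.Icc 1 d = Finset.Ico (0 + 1) (d + 1) := by
      ext j; simp
    rw [hI, ← h, Finset.range_eq_Ico]
    refine Finset.sum_congr rfl fun j _ => ?_
    push_cast
    simp
  rw [hC, ge_iff_le]
  apply le_csInf
  · refine ⟨_, WithLp.toLp 2 (fun _ => 1), 0, ?_, ?_, ?_, rfl⟩
    · intro i; simp
    · intro i; simp
    · intro h
      have := congrArg (fun x : EuclideanSpace ℝ (Fin d) => x ⟨0, hd⟩) h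
      simp at this
  · rintro _ ⟨θ₁, θ₂, -, -, hne, rfl⟩
    obtain ⟨t₁, t₂, h1, h2, h3, h4⟩ := key_vec d hd (θ₁ - θ₂)
    refine le_csSup_of_le ⟨1, ?_⟩ ⟨t₁, t₂, h1, h2, h3, rfl⟩ ?_
    · rintro _ ⟨_, _, -, -, -, rfl⟩
      exact sub_le_self _ (div_nonneg (Real.arccos_nonneg _) Real.pi_pos.le)
    · have hv : 0 < ‖θ₁ - θ₂‖ := norm_pos_iff.2 (sub_ne_zero.2 hne)
      have hC0 := Real.sqrt_nonneg (∑ j ∈ Finset.range d, (√((j : ℝ) + 1) - √(j : ℝ)) ^ 2)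
      have hCp : 0 < √(∑ j ∈ Finset.range d, (√((j : ℝ) + 1) - √(j : ℝ)) ^ 2) := by
        rcases hC0.eq_or_lt with h | h
        · rw [← h, mul_zero] at h4; linarith
        · exact h
      refine sub_le_sub_left (div_le_div_of_nonneg_right (Real.arccos_le_arccos ?_)
        Real.pi_pos.le) _
      rw [div_le_iff₀ hCp, mul_comm ‖θ₁ - θ₂‖, ← div_div, div_mul_eq_mul_div, le_div_iff₀ hv,
        one_mul]
      exact h4
end

section
/- Let d ≥ 1 and let θ ∈ ℝ^d satisfy θ₁ ≥ θ₂ ≥ … ≥ θ_d ≥ 0 and ‖θ‖₂ = 1. Then the maximum over 1 ≤ j ≤ d of (Σ_{i=1}^j θ_i)/√j is at least 1/√(Σ_{j=1}^d (√j − √(j−1))²). -/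
theorem abel_aux_s9 (d : ℕ) (f a : ℕ → ℝ) (hf : Antitone f)
    (ha : ∀ n ≤ d, 0 ≤ ∑ i ∈ Finset.range n, a i) :
    ∀ n ≤ d, f n * ∑ i ∈ Finset.range n, a i ≤ ∑ i ∈ Finset.range n, f i * a i := by
  intro n
  induction n with
  | zero => simp
  | succ n ih =>
    intro hn
    have h1 := ih (by omega)
    have h2 := mul_le_mul_of_nonneg_right (hf (Nat.le_succ n)) (ha (n + 1) hn)
    refine h2.trans ?_
    rw [Finset.sum_range_succ, Finset.sum_range_succ]
    linarith [mul_add (f n) (∑ i ∈ Finset.range n, a i) (a n)]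

/-- The key extremal inequality of Lemma 4 of the paper: among unit vectors with
nonnegative decreasing coordinates, the best normalized partial-sum ratio
`max_{1≤j≤d} (Σ_{i=1}^j θ_i)/√j` is at least `1/√(Σ_{j=1}^d (√j − √(j−1))²)`. -/
theorem max_partial_sum_ratio_ge (d : ℕ) (hd : 1 ≤ d)
    (θ : EuclideanSpace ℝ (Fin d))
    (hmono : ∀ i j : Fin d, i ≤ j → θ j ≤ θ i)
    (hpos : ∀ i, 0 ≤ θ i)
    (hnorm : ‖θ‖ = 1) :
    1 / Real.sqrt (∑ j ∈ Finset.Icc 1 d,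
        (Real.sqrt (j : ℝ) - Real.sqrt ((j : ℝ) - 1)) ^ 2) ≤
    sSup {c : ℝ | ∃ j ∈ Finset.Icc 1 d,
      c = (∑ i ∈ Finset.univ.filter (fun i : Fin d => (i : ℕ) < j), θ i)
          / Real.sqrt (j : ℝ)} := by
  set M := sSup {c : ℝ | ∃ j ∈ Finset.Icc 1 d,
      c = (∑ i ∈ Finset.univ.filter (fun i : Fin d => (i : ℕ) < j), θ i)
          / Real.sqrt (j : ℝ)} with hM
  let f : ℕ → ℝ := fun i => if h : i < d then θ ⟨i, h⟩ else 0
  have hfθ : ∀ i : Fin d, f i = θ i := fun i => by simp [f]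
  have hf0 : ∀ n, 0 ≤ f n := by
    intro n
    by_cases h : n < d
    · simpa [f, h] using hpos ⟨n, h⟩
    · simp [f, h]
  have hf : Antitone f := by
    intro m n hmn
    by_cases h : n < d
    · have h' : m < d := by omega
      simpa [f, h, h'] using hmono ⟨m, h'⟩ ⟨n, h⟩ hmn
    · have := hf0 m
      simpa [f, h] using this
  have hS : ∀ j ≤ d, ∑ i ∈ Finset.univ.filter (fun i : Fin d => (i : ℕ) < j), θ i
      = ∑ i ∈ Finset.range j, f i := by
    intro j hj
    rw [Finset.sum_filter]
    simp_rw [← hfθ]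
    rw [Fin.sum_univ_eq_sum_range (fun i => if i < j then f i else 0) d, ← Finset.sum_filter]
    congr 1
    ext i
    simp only [Finset.mem_filter, Finset.mem_range]
    omega
  have hbdd : BddAbove {c : ℝ | ∃ j ∈ Finset.Icc 1 d,
      c = (∑ i ∈ Finset.univ.filter (fun i : Fin d => (i : ℕ) < j), θ i)
          / Real.sqrt (j : ℝ)} := by
    refine (((Finset.Icc 1 d).finite_toSet.image (fun j : ℕ =>
      (∑ i ∈ Finset.univ.filter (fun i : Fin d => (i : ℕ) < j), θ i)
          / Real.sqrt (j : ℝ))).subset ?_).bddAbove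
    rintro c ⟨j, hj, rfl⟩
    exact ⟨j, hj, rfl⟩
  have hle : ∀ n ≤ d, ∑ i ∈ Finset.range n, f i ≤ M * Real.sqrt n := by
    intro n hn
    rcases Nat.eq_zero_or_pos n with rfl | h
    · simp
    · rw [← hS n hn, ← div_le_iff₀ (Real.sqrt_pos.2 (by exact_mod_cast h))]
      exact le_csSup hbdd ⟨n, Finset.mem_Icc.2 ⟨h, hn⟩, rfl⟩
  let v : ℕ → ℝ := fun i => Real.sqrt ((i + 1 : ℕ) : ℝ) - Real.sqrt (i : ℝ)
  have hv : ∀ n, ∑ i ∈ Finset.range n, v i = Real.sqrt n := by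
    intro n
    simpa [v] using Finset.sum_range_sub (fun i : ℕ => Real.sqrt (i : ℝ)) n
  have hden : ∑ j ∈ Finset.Icc 1 d, (Real.sqrt (j : ℝ) - Real.sqrt ((j : ℝ) - 1)) ^ 2
      = ∑ i ∈ Finset.range d, v i ^ 2 := by
    rw [← Finset.Ico_add_one_right_eq_Icc, Finset.sum_Ico_eq_sum_range]
    refine Finset.sum_congr (by simp) fun i _ => ?_
    simp only [v]
    push_cast
    rw [add_comm (1 : ℝ) i, add_sub_cancel_right]
  have hsum : ∀ n, ∑ i ∈ Finset.range n, (M * v i - f i)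
      = M * Real.sqrt n - ∑ i ∈ Finset.range n, f i := by
    intro n
    rw [Finset.sum_sub_distrib, ← Finset.mul_sum, hv]
  have ha : ∀ n ≤ d, 0 ≤ ∑ i ∈ Finset.range n, (M * v i - f i) := by
    intro n hn
    rw [hsum]
    linarith [hle n hn]
  have hab := abel_aux_s9 d f _ hf ha d le_rfl
  have hfd : f d = 0 := by simp [f]
  have hexp : ∑ i ∈ Finset.range d, f i * (M * v i - f i)
      = M * ∑ i ∈ Finset.range d, f i * v i - ∑ i ∈ Finset.range d, f i ^ 2 := by
    rw [Finset.mul_sum, ← Finset.sum_sub_distrib]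
    exact Finset.sum_congr rfl fun i _ => by ring
  have hn1 : ∑ i ∈ Finset.range d, f i ^ 2 = 1 := by
    rw [← Fin.sum_univ_eq_sum_range (fun i => f i ^ 2) d]
    simp_rw [hfθ]
    rw [← EuclideanSpace.real_norm_sq_eq, hnorm, one_pow]
  rw [hexp, hfd, zero_mul, hn1] at hab
  have hM0 : 0 ≤ M := by
    have h1 := hle 1 hd
    simp at h1
    exact (hf0 0).trans h1
  have hcs := Real.sum_mul_le_sqrt_mul_sqrt (Finset.range d) f v
  rw [hn1, Real.sqrt_one, one_mul] at hcs
  rw [hden]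
  have h1 : 1 ≤ M * Real.sqrt (∑ i ∈ Finset.range d, v i ^ 2) := by
    linarith [mul_le_mul_of_nonneg_left hcs hM0]
  have hp : 0 < Real.sqrt (∑ i ∈ Finset.range d, v i ^ 2) := by
    rcases (Real.sqrt_nonneg (∑ i ∈ Finset.range d, v i ^ 2)).lt_or_eq with h | h
    · exact h
    · rw [← h, mul_zero] at h1
      linarith
  rwa [div_le_iff₀ hp]
end

section
/- Let d ≥ 1 and let R₁, R₂ ∈ [0,1]^d with R₁ ≠ R₂. Then the supremum over R̂₁, R̂₂ ∈ {0,1}^d with R̂₁ ≠ R̂₂ of the quantity 1 − arccos(((R₁−R₂)·(R̂₁−R̂₂))/(‖R₁−R₂‖₂‖R̂₁−R̂₂‖₂))/π equals 1 − arccos( max_{1≤j≤d} (Σ_{i=1}^j |R₁−R₂|_{(i)})/(√j·‖R₁−R₂‖₂) )/π, where |R₁−R₂|_{(i)} denotes the i-th largest value among the absolute values of the coordinates of R₁−R₂. -/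
open scoped RealInnerProductSpace

/-- `topAbsSum w j` is the sum of the `j` largest absolute values of the coordinates of
`w`, i.e. `Σ_{i=1}^j |w|_{(i)}`, expressed as the maximum over subsets of size `j` of the
sum of `|w i|` over the subset. -/
noncomputable def topAbsSum {d : ℕ} (w : EuclideanSpace ℝ (Fin d)) (j : ℕ) : ℝ :=
  sSup {s : ℝ | ∃ S : Finset (Fin d), S.card = j ∧ s = ∑ i ∈ S, |w i|}

/-- The set defining `topAbsSum` is finite. -/
lemma topAbs_finite {d : ℕ} (w : EuclideanSpace ℝ (Fin d)) (j : ℕ) :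
    {s : ℝ | ∃ S : Finset (Fin d), S.card = j ∧ s = ∑ i ∈ S, |w i|}.Finite := by
  refine (Set.finite_range (fun S : Finset (Fin d) => ∑ i ∈ S, |w i|)).subset ?_
  rintro s ⟨S, -, rfl⟩
  exact ⟨S, rfl⟩

lemma le_topAbsSum {d : ℕ} (w : EuclideanSpace ℝ (Fin d)) (S : Finset (Fin d)) :
    ∑ i ∈ S, |w i| ≤ topAbsSum w S.card :=
  le_csSup (topAbs_finite w S.card).bddAbove ⟨S, rfl, rfl⟩

lemma exists_topAbsSum {d : ℕ} (w : EuclideanSpace ℝ (Fin d)) (j : ℕ) (hj : j ≤ d) :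
    ∃ S : Finset (Fin d), S.card = j ∧ topAbsSum w j = ∑ i ∈ S, |w i| := by
  have hne : {s : ℝ | ∃ S : Finset (Fin d), S.card = j ∧ s = ∑ i ∈ S, |w i|}.Nonempty := by
    obtain ⟨S, -, hS⟩ := Finset.exists_subset_card_eq
      (s := (Finset.univ : Finset (Fin d))) (n := j) (by simpa using hj)
    exact ⟨_, S, hS, rfl⟩
  exact hne.csSup_mem (topAbs_finite w j)

/-- Norm of a vector with entries `±1` on `S` and `0` elsewhere. -/
lemma norm_signs {d : ℕ} (v : EuclideanSpace ℝ (Fin d)) (S : Finset (Fin d))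
    (h : ∀ i, v i ^ 2 = if i ∈ S then 1 else 0) : ‖v‖ = Real.sqrt (S.card : ℝ) := by
  rw [EuclideanSpace.norm_eq]
  simp [h]

/-- The pointwise identity in the third equality of Theorem 2 of the paper: for
`R₁ ≠ R₂` in the unit cube, the sup over binary `R̂₁ ≠ R̂₂` of
`1 − arccos(((R₁−R₂)·(R̂₁−R̂₂))/(‖R₁−R₂‖‖R̂₁−R̂₂‖))/π` equals
`1 − arccos(max_{1≤j≤d} (Σ_{i=1}^j |R₁−R₂|_{(i)})/(√j ‖R₁−R₂‖))/π`. -/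
theorem sup_binary_accuracy_eq (d : ℕ) (hd : 1 ≤ d)
    (R₁ R₂ : EuclideanSpace ℝ (Fin d))
    (h₁ : ∀ i, R₁ i ∈ Set.Icc (0:ℝ) 1) (h₂ : ∀ i, R₂ i ∈ Set.Icc (0:ℝ) 1)
    (hne : R₁ ≠ R₂) :
    sSup {b : ℝ | ∃ Rh₁ Rh₂ : EuclideanSpace ℝ (Fin d),
        (∀ i, Rh₁ i = 0 ∨ Rh₁ i = 1) ∧ (∀ i, Rh₂ i = 0 ∨ Rh₂ i = 1) ∧ Rh₁ ≠ Rh₂ ∧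
        b = 1 - Real.arccos (⟪R₁ - R₂, Rh₁ - Rh₂⟫ / (‖R₁ - R₂‖ * ‖Rh₁ - Rh₂‖)) / Real.pi} =
    1 - Real.arccos (sSup {c : ℝ | ∃ j ∈ Finset.Icc 1 d,
        c = topAbsSum (R₁ - R₂) j / (Real.sqrt (j : ℝ) * ‖R₁ - R₂‖)}) / Real.pi := by
  have hN : 0 < ‖R₁ - R₂‖ := norm_pos_iff.2 (sub_ne_zero.2 hne)
  set w := R₁ - R₂ with hw
  clear_value w
  have hfin : {c : ℝ | ∃ j ∈ Finset.Icc 1 d,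
      c = topAbsSum w j / (Real.sqrt (j : ℝ) * ‖w‖)}.Finite := by
    refine ((Finset.Icc 1 d).finite_toSet.image
      (fun j : ℕ => topAbsSum w j / (Real.sqrt (j : ℝ) * ‖w‖))).subset ?_
    rintro c ⟨j, hj, rfl⟩
    exact ⟨j, hj, rfl⟩
  have hnon : {c : ℝ | ∃ j ∈ Finset.Icc 1 d,
      c = topAbsSum w j / (Real.sqrt (j : ℝ) * ‖w‖)}.Nonempty :=
    ⟨_, 1, by simpa using hd, rfl⟩
  refine IsGreatest.csSup_eq ⟨?_, ?_⟩
  · obtain ⟨j, hj, hc⟩ := hnon.csSup_mem hfin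
    rw [hc]
    rw [Finset.mem_Icc] at hj
    obtain ⟨S, hS, hT⟩ := exists_topAbsSum w j hj.2
    let A : EuclideanSpace ℝ (Fin d) :=
      WithLp.toLp 2 (fun i => if i ∈ S ∧ 0 ≤ w i then (1:ℝ) else 0)
    let B : EuclideanSpace ℝ (Fin d) :=
      WithLp.toLp 2 (fun i => if i ∈ S ∧ w i < 0 then (1:ℝ) else 0)
    have hA : ∀ i, A i = if i ∈ S ∧ 0 ≤ w i then (1:ℝ) else 0 := fun i => rfl
    have hB : ∀ i, B i = if i ∈ S ∧ w i < 0 then (1:ℝ) else 0 := fun i => rfl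
    have hnorm : ‖A - B‖ = Real.sqrt (j : ℝ) := by
      rw [← hS]
      apply norm_signs
      intro i
      rw [PiLp.sub_apply, hA, hB]
      by_cases hi : i ∈ S <;> rcases lt_or_ge (w i) 0 with h | h <;>
        simp [hi, h, not_le.2, not_lt.2]
    have hinner : ⟪w, A - B⟫ = topAbsSum w j := by
      rw [hT, PiLp.inner_apply, ← Finset.sum_subset (Finset.subset_univ S)]
      · refine Finset.sum_congr rfl fun i hi => ?_
        rw [PiLp.sub_apply, hA, hB]
        rcases lt_or_ge (w i) 0 with h | h
        · simp [hi, h, not_le.2, abs_of_neg]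
        · simp [hi, h, not_lt.2, abs_of_nonneg]
      · intro i _ hi
        rw [PiLp.sub_apply, hA, hB]
        simp [hi]
    refine ⟨A, B, ?_, ?_, ?_, ?_⟩
    · intro i
      rw [hA]
      split_ifs <;> simp
    · intro i
      rw [hB]
      split_ifs <;> simp
    · intro hAB
      rw [hAB, sub_self, norm_zero] at hnorm
      have : 0 < Real.sqrt (j : ℝ) := Real.sqrt_pos.2 (by exact_mod_cast hj.1)
      linarith
    · rw [hinner, hnorm, mul_comm]
  · rintro b ⟨A, B, hA, hB, hAB, rfl⟩
    let S : Finset (Fin d) := Finset.univ.filter (fun i => (A - B) i ≠ 0)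
    have hv : ∀ i, (A - B) i = 0 ∨ (A - B) i = 1 ∨ (A - B) i = -1 := by
      intro i
      rw [PiLp.sub_apply]
      rcases hA i with h | h <;> rcases hB i with h' | h' <;> simp [h, h']
    have hnorm : ‖A - B‖ = Real.sqrt (S.card : ℝ) := by
      apply norm_signs
      intro i
      simp only [S, Finset.mem_filter, Finset.mem_univ, true_and]
      rcases hv i with h | h | h <;> rw [h] <;> norm_num
    have hpos : 0 < ‖A - B‖ := norm_pos_iff.2 (sub_ne_zero.2 hAB)
    have hinner : ⟪w, A - B⟫ ≤ topAbsSum w S.card := by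
      refine le_trans ?_ (le_topAbsSum w S)
      rw [PiLp.inner_apply, ← Finset.sum_subset (Finset.subset_univ S)]
      · refine Finset.sum_le_sum fun i _ => ?_
        rcases hv i with h | h | h <;> rw [h] <;> simp [le_abs_self, neg_le_abs]
      · intro i _ hi
        have : (A - B) i = 0 := by
          by_contra h0
          exact hi (Finset.mem_filter.2 ⟨Finset.mem_univ i, h0⟩)
        rw [this]
        simp
    have hcard : S.card ∈ Finset.Icc 1 d := by
      rw [Finset.mem_Icc]
      constructor
      · rw [hnorm, Real.sqrt_pos] at hpos
        exact_mod_cast hpos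
      · simpa using Finset.card_le_univ S
    have hle : ⟪w, A - B⟫ / (‖w‖ * ‖A - B‖) ≤ sSup {c : ℝ | ∃ j ∈ Finset.Icc 1 d,
        c = topAbsSum w j / (Real.sqrt (j : ℝ) * ‖w‖)} := by
      refine le_trans ?_ (le_csSup hfin.bddAbove ⟨S.card, hcard, rfl⟩)
      rw [← hnorm, mul_comm ‖w‖]
      exact div_le_div_of_nonneg_right hinner (by positivity)
    have := Real.arccos_le_arccos hle
    have h3 := div_le_div_of_nonneg_right this Real.pi_pos.le
    linarith
end
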